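/- arXiv:1801.05973 — 2 statements merged into one kernel-verified Lean document; each statement's English description precedes it below -/
import Mathlib

section
/- Let n ≥ 2 and let σ be an irreducible permutation of {1,…,n} with cycle invariant (λ, r) and ℓ closed cycles. If some entry of the multiset λ ∪ {r} is even, then Ā(σ) = 0. If every entry of λ ∪ {r} is odd, then n + ℓ is even and Ā(σ) = ±2^{(n+ℓ)/2}, that is |Ā(σ)| = 2^{(n+ℓ)/2}. In particular, s(σ) = ±1 if λ ∪ {r} has no even entry, and s(σ) = 0 otherwise. -/
open scoped Classical

namespace Rauzy

/-- A permutation `σ` of `{1,…,n}` (0-based: `Fin n`) is irreducible if it maps no initial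
segment `{1,…,k}` (with `k < n`) onto the final segment `{n-k+1,…,n}`. -/
def rauzyIrreducible {n : ℕ} (σ : Equiv.Perm (Fin n)) : Prop :=
  ∀ k : ℕ, 1 ≤ k → k < n →
    Finset.image (fun j => σ j) (Finset.univ.filter fun j : Fin n => j.val < k) ≠
      Finset.univ.filter fun j : Fin n => n - k ≤ j.val

/-- The permutation of the set of "top arcs plus rank-path marker" obtained by following
the paths of the cycle-invariant construction: `0` stands for the (closed-up) rank path
marker and `j ≥ 1` for the top arc between top endpoints `j` and `j+1` (1-based). -/
def cycleMap : {n : ℕ} → Equiv.Perm (Fin n) → Equiv.Perm (Fin n)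
  | 0, _ => 1
  | (n + 1), σ =>
      finRotate (n + 1) * Equiv.swap (σ 0) (Fin.last n) * σ * finRotate (n + 1) * σ⁻¹

/-- The rank `r(σ)`: the number of top arcs on the open (rank) path. -/
noncomputable def rauzyRank : {n : ℕ} → Equiv.Perm (Fin n) → ℕ
  | 0, _ => 0
  | (_ + 1), σ => Set.ncard {x | (cycleMap σ).SameCycle 0 x} - 1

/-- The cycle structure `λ(σ)`: the multiset of the lengths (numbers of top arcs) of the
closed cycles of the cycle-invariant construction. -/
noncomputable def rauzyLambda : {n : ℕ} → Equiv.Perm (Fin n) → Multiset ℕ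
  | 0, _ => 0
  | (_ + 1), σ =>
      (Finset.univ.filter fun j =>
          (∀ x, (cycleMap σ).SameCycle j x → j ≤ x) ∧ ¬ (cycleMap σ).SameCycle 0 j).val.map
        fun j => Set.ncard {x | (cycleMap σ).SameCycle j x}

/-- `χ_I(σ)`: the number of pairs of non-crossing edges of `σ` with both endpoints in `I`. -/
def chiSet {n : ℕ} (σ : Equiv.Perm (Fin n)) (I : Finset (Fin n)) : ℕ :=
  ((I ×ˢ I).filter fun pr => pr.1 < pr.2 ∧ σ pr.1 < σ pr.2).card

/-- `A(σ) = Σ_{I ⊆ [n]} (-1)^{χ_I(σ)}`. -/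
def arfA {n : ℕ} (σ : Equiv.Perm (Fin n)) : ℤ :=
  ∑ I : Finset (Fin n), (-1 : ℤ) ^ (chiSet σ I)

/-- The Arf invariant `Ā(σ) = Σ_{I ⊆ [n]} (-1)^{|I| + χ_I(σ)}`. -/
def arfBar {n : ℕ} (σ : Equiv.Perm (Fin n)) : ℤ :=
  ∑ I : Finset (Fin n), (-1 : ℤ) ^ (I.card + chiSet σ I)

/-- The sign `s(σ) ∈ {-1, 0, +1}` of the Arf invariant. -/
def arfSign {n : ℕ} (σ : Equiv.Perm (Fin n)) : ℤ := Int.sign (arfBar σ)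

/-- The nontrivial additive character of `ZMod 2`, with integer values. -/
def parityChar (a : ZMod 2) : ℤ := if a = 0 then 1 else -1

lemma parityChar_add (a b : ZMod 2) : parityChar (a + b) = parityChar a * parityChar b := by
  revert a b; decide

lemma parityChar_mul_self (a : ZMod 2) : parityChar a * parityChar a = 1 := by
  revert a; decide

lemma parityChar_sum {ι : Type*} (s : Finset ι) (f : ι → ZMod 2) :
    parityChar (∑ i ∈ s, f i) = ∏ i ∈ s, parityChar (f i) := by
  induction s using Finset.induction_on with
  | empty => rfl
  | insert a s ha ih => rw [Finset.sum_insert ha, Finset.prod_insert ha, parityChar_add, ih]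

lemma parityChar_natCast (k : ℕ) : parityChar (k : ZMod 2) = (-1) ^ k := by
  induction k with
  | zero => rfl
  | succ k ih =>
    rw [Nat.cast_succ, parityChar_add, ih, pow_succ]
    rfl

/-- The quadratic form over `ZMod 2` whose Gauss sum is the Arf invariant. -/
def arfForm {n : ℕ} (σ : Equiv.Perm (Fin n)) (v : Fin n → ZMod 2) : ZMod 2 :=
  ∑ i, v i + ∑ i, ∑ j, if i < j ∧ σ i < σ j then v i * v j else 0

/-- The `i`-th coordinate of the image of `u` under the non-crossing adjacency matrix, which is
the Gram matrix of the polar form of `arfForm`. -/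
def polarCoord {n : ℕ} (σ : Equiv.Perm (Fin n)) (u : Fin n → ZMod 2) (i : Fin n) : ZMod 2 :=
  ∑ j, if (i < j ∧ σ i < σ j) ∨ (j < i ∧ σ j < σ i) then u j else 0

/-- The radical of the polar form of `arfForm`. -/
def arfRadical {n : ℕ} (σ : Equiv.Perm (Fin n)) : Finset (Fin n → ZMod 2) :=
  Finset.univ.filter fun u => ∀ i, polarCoord σ u i = 0

lemma mem_arfRadical {n : ℕ} {σ : Equiv.Perm (Fin n)} {u : Fin n → ZMod 2} :
    u ∈ arfRadical σ ↔ ∀ i, polarCoord σ u i = 0 := by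
  simp [arfRadical]

lemma arfBar_eq_sum_parityChar {n : ℕ} (σ : Equiv.Perm (Fin n)) :
    arfBar σ = ∑ v : Fin n → ZMod 2, parityChar (arfForm σ v) := by
  refine Finset.sum_bij' (fun I _ i => if i ∈ I then 1 else 0)
    (fun v _ => Finset.univ.filter fun i => v i = 1) (by simp) (by simp)
    (fun I _ => by ext i; simp) (fun v _ => ?_) (fun I _ => ?_)
  · funext i
    have h : ∀ a : ZMod 2, (if a = 1 then (1 : ZMod 2) else 0) = a := by decide
    simp [h]
  · rw [← parityChar_natCast]
    congr 1
    rw [Nat.cast_add, arfForm]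
    congr 1
    · simp
    · rw [chiSet, Finset.card_filter, Finset.sum_product, Nat.cast_sum,
        ← Finset.sum_filter_add_sum_filter_not Finset.univ (· ∈ I)]
      rw [Finset.sum_eq_zero (s := Finset.univ.filter fun i => ¬ i ∈ I), add_zero]
      · refine Finset.sum_congr (by ext; simp) fun i hi => ?_
        rw [Nat.cast_sum, ← Finset.sum_filter_add_sum_filter_not Finset.univ (· ∈ I),
          Finset.sum_eq_zero (s := Finset.univ.filter fun i => ¬ i ∈ I), add_zero]
        · refine Finset.sum_congr (by ext; simp) fun j hj => ?_
          simp [(Finset.mem_filter.1 hi).2, (Finset.mem_filter.1 hj).2]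
        · intro j hj
          simp [(Finset.mem_filter.1 hj).2]
      · intro i hi
        simp [(Finset.mem_filter.1 hi).2]

lemma arfForm_add {n : ℕ} (σ : Equiv.Perm (Fin n)) (u v : Fin n → ZMod 2) :
    arfForm σ (u + v) = arfForm σ u + arfForm σ v + ∑ i, v i * polarCoord σ u i := by
  have h : ∑ i, v i * polarCoord σ u i =
      ∑ i, ∑ j, (if i < j ∧ σ i < σ j then v i * u j else 0) +
        ∑ i, ∑ j, (if i < j ∧ σ i < σ j then u i * v j else 0) := by
    rw [Finset.sum_comm (f := fun i j => if i < j ∧ σ i < σ j then u i * v j else 0),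
      ← Finset.sum_add_distrib]
    refine Finset.sum_congr rfl fun i _ => ?_
    rw [polarCoord, Finset.mul_sum, ← Finset.sum_add_distrib]
    refine Finset.sum_congr rfl fun j _ => ?_
    by_cases h1 : i < j
    · simp [h1, h1.not_gt]
    · simp [h1, mul_comm]
  rw [h]
  simp only [arfForm, Pi.add_apply, Finset.sum_add_distrib]
  have h2 : ∑ i, ∑ j, (if i < j ∧ σ i < σ j then (u i + v i) * (u j + v j) else 0) =
      ∑ i, ∑ j, (if i < j ∧ σ i < σ j then u i * u j else 0) +
      ∑ i, ∑ j, (if i < j ∧ σ i < σ j then v i * v j else 0) +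
      (∑ i, ∑ j, (if i < j ∧ σ i < σ j then v i * u j else 0) +
        ∑ i, ∑ j, (if i < j ∧ σ i < σ j then u i * v j else 0)) := by
    simp only [← Finset.sum_add_distrib]
    refine Finset.sum_congr rfl fun i _ => Finset.sum_congr rfl fun j _ => ?_
    split_ifs <;> ring
  rw [h2]
  ring

lemma arfForm_add_of_mem_arfRadical {n : ℕ} {σ : Equiv.Perm (Fin n)} {u : Fin n → ZMod 2}
    (hu : u ∈ arfRadical σ) (v : Fin n → ZMod 2) :
    arfForm σ (u + v) = arfForm σ u + arfForm σ v := by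
  rw [arfForm_add]
  simp [mem_arfRadical.1 hu]

lemma arfBar_eq_zero_of_arfForm_ne_zero {n : ℕ} {σ : Equiv.Perm (Fin n)} {u : Fin n → ZMod 2}
    (hu : u ∈ arfRadical σ) (hq : arfForm σ u ≠ 0) : arfBar σ = 0 := by
  have h : arfBar σ = -arfBar σ := by
    conv_lhs => rw [arfBar_eq_sum_parityChar, ← Equiv.sum_comp (Equiv.addLeft u)]
    rw [arfBar_eq_sum_parityChar, ← Finset.sum_neg_distrib]
    refine Finset.sum_congr rfl fun v _ => ?_
    rw [Equiv.coe_addLeft, arfForm_add_of_mem_arfRadical hu, parityChar_add,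
      parityChar, if_neg hq]
    ring
  omega

lemma sum_parityChar_linear {ι : Type*} [Fintype ι] [DecidableEq ι] (c : ι → ZMod 2) :
    ∑ v : ι → ZMod 2, parityChar (∑ i, v i * c i) =
      if c = 0 then 2 ^ Fintype.card ι else 0 := by
  split_ifs with hc
  · subst hc
    simp [parityChar]
  · obtain ⟨i, hi⟩ := Function.ne_iff.1 hc
    have h : ∑ v : ι → ZMod 2, parityChar (∑ i, v i * c i) =
        -∑ v : ι → ZMod 2, parityChar (∑ i, v i * c i) := by
      conv_lhs => rw [← Equiv.sum_comp (Equiv.addLeft (Pi.single i 1))]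
      rw [← Finset.sum_neg_distrib]
      refine Finset.sum_congr rfl fun v _ => ?_
      have hs : ∑ j, (Pi.single i 1 + v : ι → ZMod 2) j * c j = c i + ∑ j, v j * c j := by
        simp only [Pi.add_apply, add_mul, Finset.sum_add_distrib]
        congr 1
        rw [Finset.sum_eq_single i] <;> simp +contextual
      rw [Equiv.coe_addLeft, hs, parityChar_add, parityChar, if_neg (by simpa using hi)]
      ring
    omega

lemma arfBar_sq_of_arfForm_eq_zero {n : ℕ} {σ : Equiv.Perm (Fin n)}
    (h : ∀ u ∈ arfRadical σ, arfForm σ u = 0) :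
    arfBar σ ^ 2 = 2 ^ n * (arfRadical σ).card := by
  have h1 : arfBar σ ^ 2 = ∑ u : Fin n → ZMod 2, ∑ v : Fin n → ZMod 2,
      parityChar (arfForm σ u) * parityChar (∑ i, v i * polarCoord σ u i) := by
    rw [pow_two, arfBar_eq_sum_parityChar, Finset.sum_mul_sum, Finset.sum_comm]
    conv_rhs => rw [Finset.sum_comm]
    refine Finset.sum_congr rfl fun v _ => ?_
    rw [← Equiv.sum_comp (Equiv.addRight v)]
    refine Finset.sum_congr rfl fun u _ => ?_
    rw [Equiv.coe_addRight, arfForm_add, parityChar_add, parityChar_add]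
    linear_combination (parityChar (arfForm σ u) * parityChar (∑ i, v i * polarCoord σ u i)) *
      parityChar_mul_self (arfForm σ v)
  have h2 : ∀ u : Fin n → ZMod 2, ∑ v : Fin n → ZMod 2,
      parityChar (arfForm σ u) * parityChar (∑ i, v i * polarCoord σ u i) =
        if u ∈ arfRadical σ then 2 ^ n else 0 := by
    intro u
    rw [← Finset.mul_sum, sum_parityChar_linear, Fintype.card_fin]
    have hiff : polarCoord σ u = 0 ↔ u ∈ arfRadical σ := by
      rw [mem_arfRadical, funext_iff]; rfl
    simp only [hiff]
    split_ifs with hu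
    · rw [h u hu]; simp [parityChar]
    · simp
  rw [h1, Finset.sum_congr rfl fun u _ => h2 u]
  simp [mul_comm]

lemma sign_eq_parityChar_sum {n : ℕ} (α : Equiv.Perm (Fin n)) (p : Fin n → Prop)
    [DecidablePred p] (hp : ∀ i, p i → p (α i)) (hnp : ∀ i, ¬ p i → α i = i) (g : Fin n → ℕ)
    (hg : Function.Injective g) :
    (Equiv.Perm.sign α : ℤ) = parityChar (∑ i, ∑ j, if i < j ∧ p i ∧ p j then
      (if g (α j) < g (α i) then 1 else 0) + (if g j < g i then 1 else 0) else 0) := by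
  let f : Fin n → Fin n → ℤ := fun i j =>
    if p i then (if p j then Int.sign ((g j : ℤ) - g i) else 1)
    else if p j then -1 else Int.sign ((j.val : ℤ) - i.val)
  have hf : ∀ i j, f i j = -f j i := by
    intro i j
    simp only [f]
    split_ifs <;> first | rfl | (rw [← Int.sign_neg, neg_sub])
  have hsq : ∀ i j, i ≠ j → f i j * f i j = 1 := by
    intro i j hij
    have hs : ∀ a : ℤ, a ≠ 0 → a.sign * a.sign = 1 := by
      intro a ha
      rcases lt_or_gt_of_ne ha with h | h
      · rw [Int.sign_eq_neg_one_of_neg h]; rfl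
      · rw [Int.sign_eq_one_of_pos h]; rfl
    simp only [f]
    split_ifs
    · exact hs _ (sub_ne_zero.2 fun h => hij (hg (by exact_mod_cast h.symm)))
    · rfl
    · rfl
    · exact hs _ (sub_ne_zero.2 fun h => hij (Fin.ext (by exact_mod_cast h.symm)))
  have hprod := α.prod_Iio_comp_eq_sign_mul_prod hf
  have hsign : (Equiv.Perm.sign α : ℤ) =
      ∏ j, ∏ i ∈ Finset.Iio j, f (α i) (α j) * f i j := by
    have hone : (∏ j, ∏ i ∈ Finset.Iio j, f i j) * (∏ j, ∏ i ∈ Finset.Iio j, f i j) = 1 := by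
      simp only [← Finset.prod_mul_distrib]
      refine Finset.prod_eq_one fun j _ => Finset.prod_eq_one fun i hi => ?_
      exact hsq i j (Finset.mem_Iio.1 hi).ne
    simp only [Finset.prod_mul_distrib]
    rw [hprod, mul_assoc, hone, mul_one]
    simp
  rw [hsign, Finset.sum_comm, parityChar_sum]
  refine Finset.prod_congr rfl fun j _ => ?_
  rw [parityChar_sum, ← Finset.prod_filter_mul_prod_filter_not Finset.univ (· < j),
    Finset.prod_eq_one (s := Finset.univ.filter fun i => ¬ i < j), mul_one]
  · refine Finset.prod_congr (by ext; simp) fun i hi => ?_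
    have hij : i < j := (Finset.mem_filter.1 hi).2
    have hpi : p (α i) ↔ p i := ⟨fun h => by_contra fun h' => h' (by rwa [hnp i h'] at h), hp i⟩
    have hpj : p (α j) ↔ p j := ⟨fun h => by_contra fun h' => h' (by rwa [hnp j h'] at h), hp j⟩
    have hs : ∀ a b : Fin n, a ≠ b →
        Int.sign ((g b : ℤ) - g a) = parityChar (if g b < g a then 1 else 0) := by
      intro a b hab
      rcases lt_or_gt_of_ne (hg.ne hab) with h | h
      · rw [if_neg h.not_gt, Int.sign_eq_one_of_pos (by omega)]; rfl
      · rw [if_pos h, Int.sign_eq_neg_one_of_neg (by omega)]; rfl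
    by_cases h1 : p i <;> by_cases h2 : p j
    · rw [if_pos ⟨hij, h1, h2⟩, parityChar_add, ← hs _ _ hij.ne,
        ← hs _ _ (α.injective.ne hij.ne)]
      simp [f, hpi, hpj, h1, h2]
    · simp [f, hpi, hpj, h1, h2, parityChar]
    · simp [f, hpi, hpj, h1, h2, parityChar]
    · rw [hnp i h1, hnp j h2, hsq i j hij.ne]
      simp [h1, parityChar]
  · intro i hi
    simp [(Finset.mem_filter.1 hi).2, parityChar]

lemma sum_lt_eq_sum_comp_lt {n : ℕ} (σ : Equiv.Perm (Fin n)) (F : Fin n → Fin n → ZMod 2)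
    (hF : ∀ i j, F i j = F j i) :
    ∑ i, ∑ j, (if i < j then F i j else 0) = ∑ i, ∑ j, if σ i < σ j then F i j else 0 := by
  have h1 : ∑ i, ∑ j, (if i < j then F i j else 0) =
      ∑ i, ∑ j, (if i < j ∧ σ i < σ j then F i j else 0) +
        ∑ i, ∑ j, (if i < j ∧ σ j < σ i then F i j else 0) := by
    simp only [← Finset.sum_add_distrib]
    refine Finset.sum_congr rfl fun i _ => Finset.sum_congr rfl fun j _ => ?_
    by_cases h : i < j
    · rcases lt_or_gt_of_ne (σ.injective.ne h.ne) with h' | h' <;> simp [h, h', h'.not_gt]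
    · simp [h]
  have h2 : ∑ i, ∑ j, (if σ i < σ j then F i j else 0) =
      ∑ i, ∑ j, (if i < j ∧ σ i < σ j then F i j else 0) +
        ∑ i, ∑ j, (if j < i ∧ σ i < σ j then F j i else 0) := by
    simp only [← Finset.sum_add_distrib]
    refine Finset.sum_congr rfl fun i _ => Finset.sum_congr rfl fun j _ => ?_
    by_cases h : σ i < σ j
    · have hne : i ≠ j := fun e => h.ne (congrArg σ e)
      rcases lt_or_gt_of_ne hne with h' | h' <;> simp [h, h', h'.not_gt, hF i j]
    · simp [h]
  rw [h1, h2, Finset.sum_comm (f := fun i j => if j < i ∧ σ i < σ j then F j i else 0)]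

lemma sum_fin_lt_eq_sum_range (n : ℕ) (f : ℕ → ℕ → ZMod 2) :
    ∑ i : Fin n, ∑ j : Fin n, (if i < j then f i j else 0) =
      ∑ j ∈ Finset.range n, ∑ i ∈ Finset.range j, f i j := by
  rw [Finset.sum_comm, Finset.sum_range]
  refine Finset.sum_congr rfl fun j _ => ?_
  simp only [Fin.lt_def]
  rw [Fin.sum_univ_eq_sum_range (fun i => if i < (j : ℕ) then f i j else 0) n,
    ← Finset.sum_filter]
  refine Finset.sum_congr ?_ fun _ _ => rfl
  ext i
  have := j.isLt
  simp only [Finset.mem_filter, Finset.mem_range]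
  omega

lemma sum_range_succ_comp (x : ℕ → ZMod 2) (k : ℕ) :
    ∑ i ∈ Finset.range k, x (i + 1) = ∑ i ∈ Finset.range k, x i + x 0 + x k := by
  have h := (Finset.sum_range_succ x k).symm.trans (Finset.sum_range_succ' x k)
  linear_combination -h - x 0 * (CharTwo.two_eq_zero : (2 : ZMod 2) = 0)

lemma arfForm_eq_of_labelling {n : ℕ} (σ : Equiv.Perm (Fin n)) (x y : ℕ → ZMod 2)
    (h0 : x 0 = 0) (hx : ∀ i : Fin n, x (i + 1) = y (σ i))
    (hx' : ∀ i : Fin n, x i = y (σ i + 1)) :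
    arfForm σ (fun i => x i + x (i + 1)) =
      (∑ i, ∑ j, if i < j ∧ σ j < σ i then x (i + 1) * x (j + 1) else 0) +
      (∑ i, ∑ j, if i < j ∧ σ j < σ i then x i * x j else 0) +
      y 0 * ∑ i : Fin n, x (i + 1) := by
  have two : (2 : ZMod 2) = 0 := CharTwo.two_eq_zero
  have hsplit : (∑ i : Fin n, ∑ j : Fin n, if i < j ∧ σ i < σ j then
        (x i + x (i + 1)) * (x j + x (j + 1)) else 0) =
      (∑ i : Fin n, ∑ j : Fin n, if i < j then
        (x i + x (i + 1)) * (x j + x (j + 1)) else 0) +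
      ((∑ i, ∑ j, if i < j ∧ σ j < σ i then x (i + 1) * x (j + 1) else 0) +
      (∑ i, ∑ j, if i < j ∧ σ j < σ i then x i * x j else 0)) +
      ((∑ i, ∑ j, if i < j ∧ σ j < σ i then x i * x (j + 1) else 0) +
      (∑ i, ∑ j, if i < j ∧ σ j < σ i then x (i + 1) * x j else 0)) := by
    simp only [← Finset.sum_add_distrib]
    refine Finset.sum_congr rfl fun i _ => Finset.sum_congr rfl fun j _ => ?_
    by_cases h : i < j
    · rcases lt_or_gt_of_ne (σ.injective.ne h.ne) with h' | h'
      · simp [h, h', h'.not_gt]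
      · simp only [h, h', h'.not_gt, and_self, and_false, if_true, if_false]
        linear_combination -((x i + x (i + 1)) * (x j + x (j + 1))) * two
    · simp [h]
  have hcross : (∑ i, ∑ j, if i < j ∧ σ j < σ i then x i * x (j + 1) else 0) +
      (∑ i, ∑ j, if i < j ∧ σ j < σ i then x (i + 1) * x j else 0) =
      (∑ i : Fin n, ∑ j : Fin n, if i < j then x i * x (j + 1) else 0) +
      (∑ i : Fin n, ∑ j : Fin n, if σ i < σ j then x i * x (j + 1) else 0) := by
    rw [Finset.sum_comm (f := fun i j => if i < j ∧ σ j < σ i then x (i + 1) * x j else 0)]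
    simp only [← Finset.sum_add_distrib]
    refine Finset.sum_congr rfl fun i _ => Finset.sum_congr rfl fun j _ => ?_
    rcases lt_trichotomy i j with h | h | h
    · rcases lt_or_gt_of_ne (σ.injective.ne h.ne) with h' | h'
      · simp only [h, h', h.not_gt, h'.not_gt, and_true, and_false, if_true, if_false]
        linear_combination -(x i * x (j + 1)) * two
      · simp [h, h', h.not_gt, h'.not_gt]
    · subst h; simp
    · rcases lt_or_gt_of_ne (σ.injective.ne h.ne) with h' | h'
      · simp [h, h', h.not_gt, h'.not_gt]
      · simp [h, h', h.not_gt, h'.not_gt, mul_comm]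
  have hbottom : (∑ i : Fin n, ∑ j : Fin n, if i < j then x i * x (j + 1) else 0) =
      (∑ i : Fin n, ∑ j : Fin n, if i < j then x (i + 1) * x (j + 1) else 0) +
        ∑ j ∈ Finset.range n, x j * x (j + 1) := by
    rw [sum_fin_lt_eq_sum_range n fun i j => x i * x (j + 1),
      sum_fin_lt_eq_sum_range n fun i j => x (i + 1) * x (j + 1), ← Finset.sum_add_distrib]
    refine Finset.sum_congr rfl fun j _ => ?_
    rw [← Finset.sum_mul, ← Finset.sum_mul, sum_range_succ_comp, h0]
    linear_combination -(x j * x (j + 1)) * two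
  have htop : (∑ i : Fin n, ∑ j : Fin n, if σ i < σ j then x i * x (j + 1) else 0) =
      (∑ i : Fin n, ∑ j : Fin n, if i < j then x (i + 1) * x (j + 1) else 0) +
        (y 0 + 1) * ∑ i : Fin n, x (i + 1) := by
    rw [sum_lt_eq_sum_comp_lt σ (fun i j => x (i + 1) * x (j + 1)) fun i j => mul_comm _ _]
    simp only [hx, hx']
    rw [Equiv.sum_comp σ fun a => ∑ j, if a < σ j then y (a + 1) * y (σ j) else 0,
      Equiv.sum_comp σ fun a => ∑ j, if a < σ j then y a * y (σ j) else 0,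
      Equiv.sum_comp σ fun a => y a,
      Finset.sum_congr rfl fun (a : Fin n) _ =>
        Equiv.sum_comp σ fun b => if a < b then y (a + 1) * y b else 0,
      Finset.sum_congr rfl fun (a : Fin n) _ =>
        Equiv.sum_comp σ fun b => if a < b then y a * y b else 0,
      sum_fin_lt_eq_sum_range n fun i j => y (i + 1) * y j,
      sum_fin_lt_eq_sum_range n fun i j => y i * y j, Fin.sum_univ_eq_sum_range,
      Finset.mul_sum, ← Finset.sum_add_distrib]
    refine Finset.sum_congr rfl fun j _ => ?_
    rw [← Finset.sum_mul, ← Finset.sum_mul, sum_range_succ_comp]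
    have hsq : ∀ a : ZMod 2, a * a = a := by decide
    linear_combination hsq (y j)
  have hdiff : (∑ i : Fin n, ∑ j : Fin n, if i < j then
        (x i + x (i + 1)) * (x j + x (j + 1)) else 0) =
      ∑ j ∈ Finset.range n, x j + ∑ j ∈ Finset.range n, x j * x (j + 1) := by
    rw [sum_fin_lt_eq_sum_range n fun i j => (x i + x (i + 1)) * (x j + x (j + 1)),
      ← Finset.sum_add_distrib]
    refine Finset.sum_congr rfl fun j _ => ?_
    rw [← Finset.sum_mul, Finset.sum_add_distrib, sum_range_succ_comp, h0]
    have hsq : ∀ a : ZMod 2, a * a = a := by decide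
    linear_combination hsq (x j) + ((∑ i ∈ Finset.range j, x i) * (x j + x (j + 1))) * two
  have hrange : ∑ i : Fin n, x (i + 1) = ∑ i ∈ Finset.range n, x (i + 1) :=
    Fin.sum_univ_eq_sum_range (fun i => x (i + 1)) n
  have hfirst : ∑ i : Fin n, (x i + x (i + 1)) =
      ∑ i ∈ Finset.range n, x i + ∑ i ∈ Finset.range n, x (i + 1) := by
    rw [Finset.sum_add_distrib, hrange, Fin.sum_univ_eq_sum_range]
  rw [arfForm, hsplit, hcross, hbottom, htop, hdiff, hfirst, hrange]
  generalize (∑ i : Fin n, ∑ j : Fin n, if i < j then x (i + 1) * x (j + 1) else 0) = e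
  generalize (∑ j ∈ Finset.range n, x j * x (j + 1)) = c
  generalize (∑ i ∈ Finset.range n, x (i + 1)) = M
  generalize (∑ i ∈ Finset.range n, x i) = N
  linear_combination (M + N + e + c) * two

lemma cycleMap_apply {m : ℕ} (σ : Equiv.Perm (Fin (m + 1))) (i : Fin (m + 1)) :
    cycleMap σ (σ i) = finRotate (m + 1)
      (Equiv.swap (σ 0) (Fin.last m) (σ (finRotate (m + 1) i))) := by
  simp [cycleMap]

lemma cycleMap_apply_last {m : ℕ} (σ : Equiv.Perm (Fin (m + 1))) :
    cycleMap σ (σ (Fin.last m)) = 0 := by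
  rw [cycleMap_apply, finRotate_last, Equiv.swap_apply_left, finRotate_last]

lemma cycleMap_apply_castSucc {m : ℕ} (σ : Equiv.Perm (Fin (m + 1))) (i : Fin m)
    (h : σ i.succ ≠ Fin.last m) :
    (cycleMap σ (σ i.castSucc)).val = (σ i.succ).val + 1 := by
  have hr : finRotate (m + 1) i.castSucc = i.succ := finRotate_of_lt i.isLt
  rw [cycleMap_apply, hr, Equiv.swap_apply_of_ne_of_ne
    (σ.injective.ne (Fin.succ_ne_zero i)) h, coe_finRotate_of_ne_last h]

lemma cycleMap_apply_castSucc_of_eq_last {m : ℕ} (σ : Equiv.Perm (Fin (m + 1))) (i : Fin m)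
    (h : σ i.succ = Fin.last m) :
    cycleMap σ (σ i.castSucc) = finRotate (m + 1) (σ 0) := by
  have hr : finRotate (m + 1) i.castSucc = i.succ := finRotate_of_lt i.isLt
  rw [cycleMap_apply, hr, h, Equiv.swap_apply_right]

lemma sign_cycleMap {m : ℕ} (σ : Equiv.Perm (Fin (m + 1))) (h : σ 0 ≠ Fin.last m) :
    Equiv.Perm.sign (cycleMap σ) = -1 := by
  have hsq : ∀ a : ℤˣ, a * a = 1 := Int.units_mul_self
  simp only [cycleMap, Equiv.Perm.sign_mul, Equiv.Perm.sign_inv, Equiv.Perm.sign_swap h]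
  generalize Equiv.Perm.sign (finRotate (m + 1)) = a
  generalize Equiv.Perm.sign σ = b
  calc a * -1 * b * a * b = -(a * a * (b * b)) := by
        simp only [mul_neg, mul_one, neg_mul, neg_inj]; ac_rfl
    _ = -1 := by rw [hsq, hsq, one_mul]

/-- The top positions reached from the bottom positions `1, …, m + 1` by following the white
points, the last bottom position being closed up with the top position `0`. -/
def topSuccessor {m : ℕ} (σ : Equiv.Perm (Fin (m + 1))) (i : Fin (m + 1)) : ℕ :=
  if i = Fin.last m then 0 else σ (finRotate (m + 1) i) + 1

lemma sum_inversions_topSuccessor {m : ℕ} (σ : Equiv.Perm (Fin (m + 1))) (x : ℕ → ZMod 2)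
    (h0 : x 0 = 0) :
    (∑ i : Fin (m + 1), ∑ j : Fin (m + 1), if i < j ∧ topSuccessor σ j < topSuccessor σ i then
      x (i + 1) * x (j + 1) else 0) =
    (∑ i : Fin (m + 1), ∑ j : Fin (m + 1), if i < j ∧ σ j < σ i then x i * x j else 0) +
      (∑ i : Fin (m + 1), x (i + 1)) * x (m + 1) + x (m + 1) := by
  have hcast : ∀ i : Fin m, topSuccessor σ i.castSucc = σ i.succ + 1 := by
    intro i
    rw [topSuccessor, if_neg (Fin.castSucc_lt_last i).ne,
      show finRotate (m + 1) i.castSucc = i.succ from finRotate_of_lt i.isLt]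
  have hlast : topSuccessor σ (Fin.last m) = 0 := if_pos rfl
  have hL : ∀ i : Fin m, (∑ j : Fin (m + 1),
      if i.castSucc < j ∧ topSuccessor σ j < topSuccessor σ i.castSucc then
        x (i.castSucc + 1) * x (j + 1) else 0) =
      (∑ j : Fin m, if i < j ∧ σ j.succ < σ i.succ then x (i + 1) * x (j + 1) else 0) +
        x (i + 1) * x (m + 1) := by
    intro i
    rw [Fin.sum_univ_castSucc]
    simp [hcast, hlast, Fin.castSucc_lt_last]
  have hL' : (∑ j : Fin (m + 1),
      if Fin.last m < j ∧ topSuccessor σ j < topSuccessor σ (Fin.last m) then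
        x (Fin.last m + 1) * x (j + 1) else 0) = 0 :=
    Finset.sum_eq_zero fun j _ => if_neg fun h => (Fin.le_last j).not_gt h.1
  have hR : ∀ i : Fin m, (∑ j : Fin (m + 1),
      if i.succ < j ∧ σ j < σ i.succ then x i.succ * x j else 0) =
      ∑ j : Fin m, if i < j ∧ σ j.succ < σ i.succ then x (i + 1) * x (j + 1) else 0 := by
    intro i
    rw [Fin.sum_univ_succ]
    simp
  have hR' : (∑ j : Fin (m + 1),
      if 0 < j ∧ σ j < σ 0 then x (0 : Fin (m + 1)) * x j else 0) = 0 := by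
    simp [h0]
  rw [Fin.sum_univ_castSucc, hL', Finset.sum_congr rfl fun i _ => hL i, Fin.sum_univ_succ
    (f := fun i => ∑ j, if i < j ∧ σ j < σ i then x i * x j else 0), hR',
    Finset.sum_congr rfl fun i _ => hR i, Finset.sum_add_distrib, ← Finset.sum_mul,
    Fin.sum_univ_castSucc (f := fun i : Fin (m + 1) => x (i + 1))]
  simp only [Fin.val_castSucc, Fin.val_last]
  have hsq : ∀ a : ZMod 2, a * a = a := by decide
  linear_combination -hsq (x (m + 1)) - x (m + 1) * (CharTwo.two_eq_zero : (2 : ZMod 2) = 0)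

/-- Labellings of the arcs of the diagram of `σ` by `ZMod 2` which are constant along the paths
of the cycle-invariant construction and vanish on the `−1` mark: `x k` and `y k` are the labels
of the arcs to the left of the bottom and top endpoints `k`. -/
structure IsLabelling {m : ℕ} (σ : Equiv.Perm (Fin (m + 1))) (x y : ℕ → ZMod 2) : Prop where
  bottom_zero : x 0 = 0
  top_last : y (m + 1) = 0
  bottom_last : x (m + 1) = y 0
  white : ∀ i : Fin (m + 1), x (i + 1) = y (σ i)
  black : ∀ i : Fin (m + 1), x i = y (σ i + 1)

lemma IsLabelling.parityChar_arfForm {m : ℕ} {σ : Equiv.Perm (Fin (m + 1))} {x y : ℕ → ZMod 2}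
    (h : IsLabelling σ x y) (ρ : Equiv.Perm (Fin (m + 1)))
    (hρ : ∀ t : Fin (m + 1), y t = 1 → y (ρ t) = 1 ∧ ρ t = cycleMap σ t)
    (hρ' : ∀ t : Fin (m + 1), y t ≠ 1 → ρ t = t) :
    parityChar (arfForm σ fun i => x i + x (i + 1)) =
      parityChar (y 0) * (Equiv.Perm.sign ρ : ℤ) := by
  obtain ⟨h0, hm, hxy, hx, hx'⟩ := h
  have hsign : Equiv.Perm.sign ρ = Equiv.Perm.sign (σ⁻¹ * ρ * σ) := by
    rw [Equiv.Perm.sign_mul, Equiv.Perm.sign_mul, Equiv.Perm.sign_inv, mul_right_comm,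
      Int.units_mul_self, one_mul]
  have hψ : ∀ i : Fin (m + 1), x (i + 1) = 1 → (σ ((σ⁻¹ * ρ * σ) i)).val = topSuccessor σ i := by
    intro i hi
    have hy : y (σ i) = 1 := by rw [← hx, hi]
    have happ : σ ((σ⁻¹ * ρ * σ) i) = ρ (σ i) := by simp
    rw [happ, (hρ _ hy).2]
    induction i using Fin.lastCases with
    | last => rw [cycleMap_apply_last]; simp [topSuccessor]
    | cast i =>
      have hne : σ i.succ ≠ Fin.last m := by
        intro h
        have := hx' i.succ
        rw [h, Fin.val_last, hm, Fin.val_succ] at this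
        rw [Fin.val_castSucc, this] at hi
        exact zero_ne_one hi
      rw [cycleMap_apply_castSucc σ i hne, topSuccessor, if_neg (Fin.castSucc_lt_last i).ne,
        show finRotate (m + 1) i.castSucc = i.succ from finRotate_of_lt i.isLt]
  rw [hsign, sign_eq_parityChar_sum (σ⁻¹ * ρ * σ) (fun i => x (i + 1) = 1) ?_ ?_
    (fun i => (σ i).val) (Fin.val_injective.comp σ.injective), ← parityChar_add,
    arfForm_eq_of_labelling σ x y h0 hx hx']
  · congr 1
    have hstep : (∑ i : Fin (m + 1), ∑ j : Fin (m + 1),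
        if i < j ∧ x (i + 1) = 1 ∧ x (j + 1) = 1 then
          (if (σ ((σ⁻¹ * ρ * σ) j)).val < (σ ((σ⁻¹ * ρ * σ) i)).val then (1 : ZMod 2) else 0) +
          (if (σ j).val < (σ i).val then 1 else 0) else 0) =
        (∑ i : Fin (m + 1), ∑ j : Fin (m + 1),
          if i < j ∧ topSuccessor σ j < topSuccessor σ i then
            x (i + 1) * x (j + 1) else 0) +
        ∑ i : Fin (m + 1), ∑ j : Fin (m + 1),
          if i < j ∧ σ j < σ i then x (i + 1) * x (j + 1) else 0 := by
      simp only [← Finset.sum_add_distrib]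
      refine Finset.sum_congr rfl fun i _ => Finset.sum_congr rfl fun j _ => ?_
      have h01 : ∀ a : ZMod 2, a ≠ 1 → a = 0 := by decide
      by_cases hi : x (i + 1) = 1
      · by_cases hj : x (j + 1) = 1
        · rw [hψ i hi, hψ j hj]
          by_cases hij : i < j <;> simp [hi, hj, hij]
        · simp [h01 _ hj]
      · simp [h01 _ hi]
    rw [hstep, sum_inversions_topSuccessor σ x h0, hxy]
    linear_combination -y 0 * (CharTwo.two_eq_zero : (2 : ZMod 2) = 0)
  · intro i hi
    have hy : y (σ i) = 1 := by rw [← hx, hi]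
    rw [hx]
    simpa using (hρ _ hy).1
  · intro i hi
    rw [hx] at hi
    simp [hρ' _ hi]

/-- The sum of `u` over the edges of `σ` whose top endpoint is one of the first `k`. -/
def prefixSum {n : ℕ} (σ : Equiv.Perm (Fin n)) (u : Fin n → ZMod 2) (k : ℕ) : ZMod 2 :=
  ∑ j, if (σ j).val < k then u j else 0

lemma prefixSum_zero {n : ℕ} (σ : Equiv.Perm (Fin n)) (u : Fin n → ZMod 2) :
    prefixSum σ u 0 = 0 := by
  simp [prefixSum]

lemma prefixSum_succ {n : ℕ} (σ : Equiv.Perm (Fin n)) (u : Fin n → ZMod 2) (i : Fin n) :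
    prefixSum σ u (σ i + 1) = prefixSum σ u (σ i) + u i := by
  have h : u i = ∑ j, if j = i then u j else 0 := by simp
  rw [prefixSum, prefixSum, h, ← Finset.sum_add_distrib]
  refine Finset.sum_congr rfl fun j _ => ?_
  have hj : j = i ↔ (σ j).val = (σ i).val := by rw [← Fin.ext_iff, σ.injective.eq_iff]
  simp only [hj]
  rcases lt_trichotomy (σ j).val (σ i).val with h | h | h
  · simp [h, h.ne, Nat.lt_succ_of_lt h]
  · simp [h]
  · simp [h.not_gt, h.ne', show ¬ (σ j).val < σ i + 1 by omega]

lemma prefixSum_last {n : ℕ} (σ τ : Equiv.Perm (Fin n)) (u : Fin n → ZMod 2) :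
    prefixSum σ u n = prefixSum τ u n := by
  simp [prefixSum]

lemma polarCoord_eq_prefixSum {n : ℕ} (σ : Equiv.Perm (Fin n)) (u : Fin n → ZMod 2) (i : Fin n) :
    polarCoord σ u i = prefixSum σ u n + prefixSum 1 u (i + 1) + prefixSum σ u (σ i) := by
  have two : (2 : ZMod 2) = 0 := CharTwo.two_eq_zero
  simp only [polarCoord, prefixSum, ← Finset.sum_add_distrib]
  refine Finset.sum_congr rfl fun j _ => ?_
  rw [if_pos (σ j).isLt]
  rcases lt_trichotomy j i with h | h | h
  · have h1 : ((1 : Equiv.Perm (Fin n)) j).val < i + 1 := Nat.lt_succ_of_lt h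
    rw [if_pos h1]
    rcases lt_or_gt_of_ne (σ.injective.ne h.ne) with h' | h'
    · rw [if_pos (Or.inr ⟨h, h'⟩), if_pos (Fin.lt_def.1 h')]
      linear_combination -(u j) * two
    · rw [if_neg (by simp [h.not_gt, h'.not_gt]), if_neg (Fin.lt_def.not.1 h'.not_gt)]
      linear_combination -(u j) * two
  · subst h
    simp only [lt_irrefl, false_and, or_self, if_false, Equiv.Perm.one_apply, Nat.lt_succ_self,
      if_true]
    linear_combination -(u j) * two
  · have h1 : ¬ ((1 : Equiv.Perm (Fin n)) j).val < i + 1 := by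
      have := Fin.lt_def.1 h
      rw [Equiv.Perm.one_apply]
      omega
    rw [if_neg h1]
    rcases lt_or_gt_of_ne (σ.injective.ne h.ne) with h' | h'
    · rw [if_pos (Or.inl ⟨h, h'⟩), if_neg (Fin.lt_def.not.1 h'.not_gt)]
      ring
    · rw [if_neg (by simp [h.not_gt, h'.not_gt]), if_pos (Fin.lt_def.1 h')]
      linear_combination -(u j) * two

lemma isLabelling_of_mem_arfRadical {m : ℕ} {σ : Equiv.Perm (Fin (m + 1))}
    {u : Fin (m + 1) → ZMod 2} (hu : u ∈ arfRadical σ) :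
    IsLabelling σ (prefixSum 1 u) (fun k => prefixSum σ u (m + 1) + prefixSum σ u k) := by
  have two : (2 : ZMod 2) = 0 := CharTwo.two_eq_zero
  have hw : ∀ i : Fin (m + 1),
      prefixSum 1 u (i + 1) = prefixSum σ u (m + 1) + prefixSum σ u (σ i) := by
    intro i
    have h := mem_arfRadical.1 hu i
    rw [polarCoord_eq_prefixSum] at h
    linear_combination h - (prefixSum σ u (m + 1) + prefixSum σ u (σ i)) * two
  refine ⟨prefixSum_zero _ _, ?_, ?_, hw, fun i => ?_⟩
  · linear_combination prefixSum σ u (m + 1) * two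
  · rw [prefixSum_zero, prefixSum_last 1 σ, add_zero]
  · have h1 := prefixSum_succ 1 u i
    rw [Equiv.Perm.one_apply] at h1
    have h2 := prefixSum_succ σ u i
    linear_combination hw i - h1 - h2 - u i * two

lemma eq_prefixSum_add {n : ℕ} (u : Fin n → ZMod 2) :
    u = fun i : Fin n => prefixSum 1 u i + prefixSum 1 u (i + 1) := by
  funext i
  have h1 := prefixSum_succ 1 u i
  rw [Equiv.Perm.one_apply] at h1
  rw [h1, ← add_assoc, CharTwo.add_self_eq_zero, zero_add]

lemma prefixSum_eq_of_forall {n : ℕ} (σ : Equiv.Perm (Fin n)) (u : Fin n → ZMod 2)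
    (z : ℕ → ZMod 2) (h : ∀ i, u i = z (σ i) + z (σ i + 1)) (k : ℕ) (hk : k ≤ n) :
    prefixSum σ u k = z 0 + z k := by
  induction k with
  | zero => rw [prefixSum_zero, CharTwo.add_self_eq_zero]
  | succ k ih =>
    have hs := prefixSum_succ σ u (σ.symm ⟨k, hk⟩)
    have hz := h (σ.symm ⟨k, hk⟩)
    rw [Equiv.apply_symm_apply] at hs hz
    simp only at hs hz
    rw [hs, ih (by omega), hz]
    linear_combination z k * (CharTwo.two_eq_zero : (2 : ZMod 2) = 0)

namespace IsLabelling

variable {m : ℕ} {σ : Equiv.Perm (Fin (m + 1))} {x y : ℕ → ZMod 2}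

lemma prefixSum_top (h : IsLabelling σ x y) (k : ℕ) (hk : k ≤ m + 1) :
    prefixSum σ (fun i => x i + x (i + 1)) k = y 0 + y k :=
  prefixSum_eq_of_forall σ _ y (fun i => by rw [h.white, h.black, add_comm]) k hk

lemma mem_arfRadical (h : IsLabelling σ x y) :
    (fun i : Fin (m + 1) => x i + x (i + 1)) ∈ arfRadical σ := by
  refine Rauzy.mem_arfRadical.2 fun i => ?_
  have hb : prefixSum 1 (fun i : Fin (m + 1) => x i + x (i + 1)) (i + 1) = x 0 + x (i + 1) :=
    prefixSum_eq_of_forall 1 _ x (fun _ => rfl) _ i.isLt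
  rw [polarCoord_eq_prefixSum, h.prefixSum_top _ le_rfl, h.prefixSum_top _ (σ i).isLt.le, hb, h.top_last, h.bottom_zero, h.white]
  linear_combination (y 0 + y (σ i)) * (CharTwo.two_eq_zero : (2 : ZMod 2) = 0)

lemma top_finRotate (h : IsLabelling σ x y) (h0 : σ 0 ≠ Fin.last m) :
    y (finRotate (m + 1) (σ 0)) = 0 := by
  rw [coe_finRotate_of_ne_last h0, ← h.black, Fin.val_zero, h.bottom_zero]

lemma top_cycleMap (h : IsLabelling σ x y) (h0 : σ 0 ≠ Fin.last m) (t : Fin (m + 1)) :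
    y (cycleMap σ t) = y t := by
  obtain ⟨i, rfl⟩ := σ.surjective t
  induction i using Fin.lastCases with
  | last =>
    rw [cycleMap_apply_last, ← h.white, Fin.val_last, h.bottom_last, Fin.val_zero]
  | cast i =>
    have hx := h.black i.succ
    rw [← h.white, Fin.val_castSucc, ← Fin.val_succ]
    by_cases hi : σ i.succ = Fin.last m
    · rw [cycleMap_apply_castSucc_of_eq_last σ i hi, h.top_finRotate h0, hx, hi, Fin.val_last,
        h.top_last]
    · rw [cycleMap_apply_castSucc σ i hi, hx]

end IsLabelling

lemma exists_isLabelling {m : ℕ} (σ : Equiv.Perm (Fin (m + 1))) (h0 : σ 0 ≠ Fin.last m)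
    (h : Fin (m + 1) → ZMod 2) (hc : ∀ t, h (cycleMap σ t) = h t)
    (hmark : h (finRotate (m + 1) (σ 0)) = 0) :
    ∃ x y, IsLabelling σ x y ∧ ∀ t : Fin (m + 1), y t = h t := by
  let y : ℕ → ZMod 2 := fun k => if hk : k < m + 1 then h ⟨k, hk⟩ else 0
  let x : ℕ → ZMod 2 := fun k => if hk : k - 1 < m + 1 ∧ k ≠ 0 then h (σ ⟨k - 1, hk.1⟩) else 0
  have hy : ∀ t : Fin (m + 1), y t = h t := fun t => dif_pos t.isLt
  have hx : ∀ i : Fin (m + 1), x (i + 1) = h (σ i) := fun i =>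
    dif_pos ⟨i.isLt, Nat.succ_ne_zero _⟩
  have hm : y (m + 1) = 0 := by simp [y]
  refine ⟨x, y, ⟨by simp [x], hm, ?_, fun i => by rw [hx, hy], fun i => ?_⟩, hy⟩
  · have h1 := hx (Fin.last m)
    have h2 := hy 0
    rw [Fin.val_zero] at h2
    rw [Fin.val_last] at h1
    rw [h1, h2, ← cycleMap_apply_last σ, hc]
  · induction i using Fin.cases with
    | zero =>
      have h1 := hy (finRotate (m + 1) (σ 0))
      rw [coe_finRotate_of_ne_last h0] at h1
      rw [h1, hmark]
      simp [x]
    | succ i =>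
      rw [Fin.val_succ, ← Fin.val_castSucc, hx, ← hc]
      by_cases hi : σ i.succ = Fin.last m
      · rw [cycleMap_apply_castSucc_of_eq_last σ i hi, hmark, hi, Fin.val_last, hm]
      · rw [← cycleMap_apply_castSucc σ i hi, hy]

/-- The number of `x` in the cycle of `π` through `j`. -/
noncomputable def cycleLength {n : ℕ} (π : Equiv.Perm (Fin n)) (j : Fin n) : ℕ :=
  Set.ncard {x | π.SameCycle j x}

lemma sign_cycleOf {n : ℕ} (π : Equiv.Perm (Fin n)) (j : Fin n) :
    Equiv.Perm.sign (π.cycleOf j) = -(-1) ^ cycleLength π j := by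
  by_cases h : π j = j
  · have hs : {x | π.SameCycle j x} = {j} := by
      ext x
      refine ⟨fun hx => ?_, fun hx => ?_⟩
      · exact (hx.eq_of_left h).symm
      · rw [Set.mem_singleton_iff.1 hx]
        exact Equiv.Perm.SameCycle.refl _ _
    rw [(Equiv.Perm.cycleOf_eq_one_iff π).2 h, cycleLength, hs]
    simp
  · have hs : {x | π.SameCycle j x} = ((π.cycleOf j).support : Set (Fin n)) := by
      ext x
      rw [Finset.mem_coe, Equiv.Perm.mem_support_cycleOf_iff' h]
      rfl
    rw [(π.isCycle_cycleOf h).sign, cycleLength, hs, Set.ncard_coe_finset]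

lemma cycleLength_pos {n : ℕ} (π : Equiv.Perm (Fin n)) (j : Fin n) : 0 < cycleLength π j :=
  (Set.ncard_pos (Set.toFinite _)).2 ⟨j, Equiv.Perm.SameCycle.refl _ _⟩

lemma cycleLength_congr {n : ℕ} {π : Equiv.Perm (Fin n)} {i j : Fin n} (h : π.SameCycle i j) :
    cycleLength π i = cycleLength π j := by
  have : {x | π.SameCycle i x} = {x | π.SameCycle j x} :=
    Set.ext fun x => ⟨fun hx => h.symm.trans hx, fun hx => h.trans hx⟩
  rw [cycleLength, cycleLength, this]

/-- The condition that all closed cycles and the rank path have odd length, in terms of signs: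
the closed-up rank path has one more element than its length. -/
def HasOddCycles {m : ℕ} (σ : Equiv.Perm (Fin (m + 1))) : Prop :=
  ∀ j, Equiv.Perm.sign ((cycleMap σ).cycleOf j) = if (cycleMap σ).SameCycle j 0 then -1 else 1

lemma HasOddCycles.sign_eq {m : ℕ} {σ : Equiv.Perm (Fin (m + 1))} (h : HasOddCycles σ)
    (ρ : Equiv.Perm (Fin (m + 1))) (hρ : ∀ t, ρ t ≠ t → ρ t = cycleMap σ t) :
    Equiv.Perm.sign ρ = if ρ 0 ≠ 0 then -1 else 1 := by
  revert hρ
  induction ρ using Equiv.Perm.cycle_induction_on with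
  | base_one => simp
  | base_cycles c hc =>
    intro hρ
    obtain ⟨j, hj, -⟩ := id hc
    have hmem : c ∈ (cycleMap σ).cycleFactorsFinset :=
      Equiv.Perm.mem_cycleFactorsFinset_iff.2 ⟨hc, fun a ha => hρ a (Equiv.Perm.mem_support.1 ha)⟩
    have hcj := Equiv.Perm.cycle_is_cycleOf (Equiv.Perm.mem_support.2 hj) hmem
    have hπ : cycleMap σ j ≠ j := by rwa [← hρ j hj]
    have hiff : (cycleMap σ).SameCycle j 0 ↔ c 0 ≠ 0 := by
      rw [← Equiv.Perm.mem_support_cycleOf_iff' hπ, ← hcj, Equiv.Perm.mem_support]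
    conv_lhs => rw [hcj, h j]
    simp only [hiff]
  | induction_disjoint c τ hd _ ihc ihτ =>
    intro hρ
    have hc : ∀ t, c t ≠ t → c t = cycleMap σ t := by
      intro t ht
      have hτ := (hd t).resolve_left ht
      have := hρ t
      rw [Equiv.Perm.mul_apply, hτ] at this
      exact this ht
    have hτ : ∀ t, τ t ≠ t → τ t = cycleMap σ t := by
      intro t ht
      have hct := (hd (τ t)).resolve_right (τ.injective.ne ht)
      have := hρ t
      rw [Equiv.Perm.mul_apply, hct] at this
      exact this ht
    rw [Equiv.Perm.sign_mul, ihc hc, ihτ hτ]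
    rcases hd 0 with h0 | h0
    · by_cases h1 : τ 0 = 0
      · simp [h0, h1]
      · have h2 := (hd (τ 0)).resolve_right (τ.injective.ne h1)
        simp [h0, h1, h2]
    · simp [h0]

lemma HasOddCycles.arfForm_eq_zero {m : ℕ} {σ : Equiv.Perm (Fin (m + 1))} (h : HasOddCycles σ)
    (h0 : σ 0 ≠ Fin.last m) {u : Fin (m + 1) → ZMod 2} (hu : u ∈ arfRadical σ) :
    arfForm σ u = 0 := by
  have hlab := isLabelling_of_mem_arfRadical hu
  rw [eq_prefixSum_add u]
  generalize prefixSum 1 u = x at *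
  generalize hy : (fun k => prefixSum σ u (m + 1) + prefixSum σ u k) = y at *
  let p : Fin (m + 1) → Prop := fun t => y t = 1
  have hp : ∀ t, p (cycleMap σ t) ↔ p t := fun t => by
    simp only [p, hlab.top_cycleMap h0]
  let ρ := Equiv.Perm.ofSubtype ((cycleMap σ).subtypePerm hp)
  have hρ : ∀ t : Fin (m + 1), y t = 1 → ρ t = cycleMap σ t := fun t (ht : p t) => by
    simp only [ρ, Equiv.Perm.ofSubtype_apply_of_mem _ ht, Equiv.Perm.subtypePerm_apply]
  have hρ' : ∀ t : Fin (m + 1), y t ≠ 1 → ρ t = t := fun t (ht : ¬ p t) =>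
    Equiv.Perm.ofSubtype_apply_of_not_mem _ ht
  have hform := hlab.parityChar_arfForm ρ
    (fun t ht => ⟨by rw [hρ t ht]; exact (hp t).2 ht, hρ t ht⟩) hρ'
  have hsign := h.sign_eq ρ fun t ht => hρ t (by_contra fun h' => ht (hρ' t h'))
  have hne : cycleMap σ 0 ≠ 0 := by
    intro hfix
    have := h 0
    rw [(Equiv.Perm.cycleOf_eq_one_iff _).2 hfix, if_pos (Equiv.Perm.SameCycle.refl _ _)] at this
    simp at this
  have hinj : ∀ a : ZMod 2, parityChar a = 1 → a = 0 := by decide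
  refine hinj _ (hform.trans ?_)
  have h01 : ∀ a : ZMod 2, a ≠ 1 → a = 0 := by decide
  by_cases hy0 : y (0 : Fin (m + 1)) = 1
  · rw [hsign, if_pos (by rwa [hρ 0 hy0]), ← Fin.val_zero (n := m + 1), hy0]
    rfl
  · rw [hsign, if_neg (not_not.2 (hρ' 0 hy0)), ← Fin.val_zero (n := m + 1), h01 _ hy0]
    rfl

lemma hasOddCycles_of_forall_arfForm_eq_zero {m : ℕ} {σ : Equiv.Perm (Fin (m + 1))}
    (h0 : σ 0 ≠ Fin.last m) (hq : ∀ u ∈ arfRadical σ, arfForm σ u = 0) : HasOddCycles σ := by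
  intro j
  set π := cycleMap σ with hπ
  have h01 : (0 : ZMod 2) ≠ 1 := by decide
  have key : ∀ (q : Fin (m + 1) → Prop) (ρ : Equiv.Perm (Fin (m + 1))),
      (∀ t, q (π t) ↔ q t) → ¬ q (finRotate (m + 1) (σ 0)) → (∀ t, q t → ρ t = π t) →
      (∀ t, ¬ q t → ρ t = t) → Equiv.Perm.sign ρ = if q 0 then -1 else 1 := by
    intro q ρ hqπ hqm hρ hρ'
    obtain ⟨x, y, hlab, hy⟩ := exists_isLabelling σ h0 (fun t => if q t then 1 else 0)
      (fun t => by simp only [← hπ, hqπ]) (if_neg hqm)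
    have hy1 : ∀ t : Fin (m + 1), y t = 1 ↔ q t := fun t => by
      rw [hy]
      by_cases hqt : q t <;> simp [hqt]
    have hform := hlab.parityChar_arfForm ρ
      (fun t ht => ⟨by rw [hy1] at ht ⊢; rw [hρ t ht]; exact (hqπ t).2 ht, hρ t ((hy1 t).1 ht)⟩)
      (fun t ht => hρ' t ((hy1 t).not.1 ht))
    rw [hq _ hlab.mem_arfRadical, ← Fin.val_zero (m + 1), hy] at hform
    have hu := Int.units_eq_one_or (Equiv.Perm.sign ρ)
    by_cases hq0 : q 0
    · rcases hu with hu | hu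
      · rw [hu, if_pos hq0] at hform
        exact absurd hform (by decide)
      · rw [hu, if_pos hq0]
    · rcases hu with hu | hu
      · rw [hu, if_neg hq0]
      · rw [hu, if_neg hq0] at hform
        exact absurd hform (by decide)
  have hinv : ∀ t, π.SameCycle j (π t) ↔ π.SameCycle j t := fun t =>
    Equiv.Perm.sameCycle_apply_right
  by_cases hm : π.SameCycle j (finRotate (m + 1) (σ 0))
  · have hs := key (fun t => ¬ π.SameCycle j t) ((π.cycleOf j)⁻¹ * π) (fun t => not_congr (hinv t))
      (not_not.2 hm) (fun t ht => ?_) (fun t ht => ?_)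
    · rw [Equiv.Perm.sign_mul, Equiv.Perm.sign_inv, hπ, sign_cycleMap σ h0, ← hπ] at hs
      by_cases hj : π.SameCycle j 0
      · rw [if_neg (not_not.2 hj)] at hs
        rw [if_pos hj]
        simpa [neg_eq_iff_eq_neg] using hs
      · rw [if_pos hj] at hs
        rw [if_neg hj]
        simpa using hs
    · rw [Equiv.Perm.mul_apply, Equiv.Perm.inv_eq_iff_eq,
        Equiv.Perm.cycleOf_apply_of_not_sameCycle (mt (hinv t).1 ht)]
    · rw [Equiv.Perm.mul_apply, Equiv.Perm.inv_eq_iff_eq,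
        (not_not.1 ht).cycleOf_apply]
  · have hs := key (fun t => π.SameCycle j t) (π.cycleOf j) hinv hm
      (fun t ht => ht.cycleOf_apply) (fun t ht => Equiv.Perm.cycleOf_apply_of_not_sameCycle ht)
    by_cases hj : π.SameCycle j 0
    · rw [hs, if_pos hj, if_pos hj]
    · rw [hs, if_neg hj, if_neg hj]

/-- The smallest element of the cycle of `π` through `t`. -/
noncomputable def cycleMin {n : ℕ} (π : Equiv.Perm (Fin n)) (t : Fin n) : Fin n :=
  (Finset.univ.filter fun x => π.SameCycle t x).min'
    ⟨t, Finset.mem_filter.2 ⟨Finset.mem_univ _, Equiv.Perm.SameCycle.refl _ _⟩⟩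

lemma sameCycle_cycleMin {n : ℕ} (π : Equiv.Perm (Fin n)) (t : Fin n) :
    π.SameCycle t (cycleMin π t) :=
  (Finset.mem_filter.1 (Finset.min'_mem (Finset.univ.filter fun x => π.SameCycle t x) _)).2

lemma cycleMin_le {n : ℕ} {π : Equiv.Perm (Fin n)} {t x : Fin n} (h : π.SameCycle t x) :
    cycleMin π t ≤ x :=
  Finset.min'_le _ _ (Finset.mem_filter.2 ⟨Finset.mem_univ _, h⟩)

lemma cycleMin_congr {n : ℕ} {π : Equiv.Perm (Fin n)} {s t : Fin n} (h : π.SameCycle s t) :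
    cycleMin π s = cycleMin π t :=
  le_antisymm (cycleMin_le (h.trans (sameCycle_cycleMin π t)))
    (cycleMin_le (h.symm.trans (sameCycle_cycleMin π s)))

/-- The smallest elements of the closed cycles of the cycle-invariant construction. -/
noncomputable def closedCycles {m : ℕ} (σ : Equiv.Perm (Fin (m + 1))) : Finset (Fin (m + 1)) :=
  Finset.univ.filter fun j =>
    (∀ x, (cycleMap σ).SameCycle j x → j ≤ x) ∧ ¬ (cycleMap σ).SameCycle 0 j

lemma mem_closedCycles {m : ℕ} {σ : Equiv.Perm (Fin (m + 1))} {j : Fin (m + 1)} :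
    j ∈ closedCycles σ ↔
      (∀ x, (cycleMap σ).SameCycle j x → j ≤ x) ∧ ¬ (cycleMap σ).SameCycle 0 j := by
  simp [closedCycles]

lemma rauzyLambda_eq_map {m : ℕ} (σ : Equiv.Perm (Fin (m + 1))) :
    rauzyLambda σ = (closedCycles σ).val.map (cycleLength (cycleMap σ)) := rfl

lemma cycleMin_mem_closedCycles {m : ℕ} {σ : Equiv.Perm (Fin (m + 1))} {t : Fin (m + 1)}
    (h : ¬ (cycleMap σ).SameCycle 0 t) : cycleMin (cycleMap σ) t ∈ closedCycles σ := by
  have ht := sameCycle_cycleMin (cycleMap σ) t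
  exact mem_closedCycles.2 ⟨fun x hx => cycleMin_le (ht.trans hx), fun h' => h (h'.trans ht.symm)⟩

lemma cycleMin_of_mem_closedCycles {m : ℕ} {σ : Equiv.Perm (Fin (m + 1))} {t : Fin (m + 1)}
    (h : t ∈ closedCycles σ) : cycleMin (cycleMap σ) t = t :=
  le_antisymm (cycleMin_le (Equiv.Perm.SameCycle.refl _ _))
    ((mem_closedCycles.1 h).1 _ (sameCycle_cycleMin _ _))

lemma eq_of_sameCycle {n : ℕ} {α : Type*} {π : Equiv.Perm (Fin n)} {f : Fin n → α}
    (hf : ∀ t, f (π t) = f t) {s t : Fin n} (h : π.SameCycle s t) : f s = f t := by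
  obtain ⟨k, -, -, rfl⟩ := h.exists_pow_eq'
  clear h
  induction k with
  | zero => rfl
  | succ k ih => rw [pow_succ', Equiv.Perm.mul_apply, hf, ih]

lemma prefixSum_eq_of_forall_closedCycles {m : ℕ} {σ : Equiv.Perm (Fin (m + 1))}
    (h0 : σ 0 ≠ Fin.last m) {u v : Fin (m + 1) → ZMod 2}
    (hu : u ∈ arfRadical σ) (hv : v ∈ arfRadical σ)
    (h : ∀ t ∈ closedCycles σ, prefixSum σ u t = prefixSum σ v t) : u = v := by
  have hinv : ∀ {w : Fin (m + 1) → ZMod 2}, w ∈ arfRadical σ → ∀ t,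
      prefixSum σ w (cycleMap σ t) = prefixSum σ w t := fun hw t =>
    add_left_cancel ((isLabelling_of_mem_arfRadical hw).top_cycleMap h0 t)
  have hlast : ∀ {w : Fin (m + 1) → ZMod 2}, w ∈ arfRadical σ →
      prefixSum σ w (m + 1) = prefixSum σ w (finRotate (m + 1) (σ 0)) := fun hw =>
    CharTwo.add_eq_zero.1 ((isLabelling_of_mem_arfRadical hw).top_finRotate h0)
  have hfin : ∀ t : Fin (m + 1), prefixSum σ u t = prefixSum σ v t := by
    intro t
    have ht := sameCycle_cycleMin (cycleMap σ) t
    by_cases h1 : (cycleMap σ).SameCycle 0 t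
    · rw [← eq_of_sameCycle (f := fun t : Fin (m + 1) => prefixSum σ u t) (hinv hu) h1,
        ← eq_of_sameCycle (f := fun t : Fin (m + 1) => prefixSum σ v t) (hinv hv) h1,
        Fin.val_zero, prefixSum_zero, prefixSum_zero]
    · rw [eq_of_sameCycle (f := fun t : Fin (m + 1) => prefixSum σ u t) (hinv hu) ht,
        eq_of_sameCycle (f := fun t : Fin (m + 1) => prefixSum σ v t) (hinv hv) ht]
      exact h _ (cycleMin_mem_closedCycles h1)
  have hall : ∀ k ≤ m + 1, prefixSum σ u k = prefixSum σ v k := by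
    intro k hk
    rcases hk.lt_or_eq with hk | rfl
    · exact hfin ⟨k, hk⟩
    · rw [hlast hu, hlast hv, hfin]
  funext i
  have h1 := prefixSum_succ σ u i
  rw [hall _ (σ i).isLt, hfin, prefixSum_succ σ v i] at h1
  exact (add_left_cancel h1).symm

lemma exists_mem_arfRadical_prefixSum {m : ℕ} {σ : Equiv.Perm (Fin (m + 1))}
    (h0 : σ 0 ≠ Fin.last m) (c : Fin (m + 1) → ZMod 2) :
    ∃ u ∈ arfRadical σ, ∀ t ∈ closedCycles σ, prefixSum σ u t = c t := by
  set e : Fin (m + 1) → ZMod 2 := fun t =>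
    if cycleMin (cycleMap σ) t ∈ closedCycles σ then c (cycleMin (cycleMap σ) t) else 0 with he
  obtain ⟨x, y, hlab, hy⟩ := exists_isLabelling σ h0
    (fun t => e t + e (finRotate (m + 1) (σ 0)))
    (fun t => by
      have ht : (cycleMap σ).SameCycle (cycleMap σ t) t :=
        Equiv.Perm.sameCycle_apply_left.2 (Equiv.Perm.SameCycle.refl _ _)
      simp only [he, cycleMin_congr ht])
    (CharTwo.add_self_eq_zero _)
  refine ⟨_, hlab.mem_arfRadical, fun t ht => ?_⟩
  have hz : e 0 = 0 := if_neg fun h =>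
    (mem_closedCycles.1 h).2 (sameCycle_cycleMin (cycleMap σ) 0)
  have het : e t = c t := by
    simp only [he]
    rw [cycleMin_of_mem_closedCycles ht, if_pos ht]
  rw [hlab.prefixSum_top _ t.isLt.le, ← Fin.val_zero (m + 1), hy, hy, hz, het]
  linear_combination e (finRotate (m + 1) (σ 0)) * (CharTwo.two_eq_zero : (2 : ZMod 2) = 0)

lemma card_arfRadical {m : ℕ} {σ : Equiv.Perm (Fin (m + 1))} (h0 : σ 0 ≠ Fin.last m) :
    (arfRadical σ).card = 2 ^ Multiset.card (rauzyLambda σ) := by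
  have hcard : (arfRadical σ).card =
      (Finset.univ : Finset (closedCycles σ → ZMod 2)).card := by
    refine Finset.card_bij (fun u _ t => prefixSum σ u (t : Fin (m + 1))) (by simp)
      (fun u hu v hv huv => ?_) (fun c _ => ?_)
    · exact prefixSum_eq_of_forall_closedCycles h0 hu hv fun t ht => congrFun huv ⟨t, ht⟩
    · obtain ⟨u, hu, h⟩ := exists_mem_arfRadical_prefixSum h0
        (fun t => if ht : t ∈ closedCycles σ then c ⟨t, ht⟩ else 0)
      refine ⟨u, hu, ?_⟩
      funext t
      rw [h t t.2, dif_pos t.2]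
  rw [hcard, rauzyLambda_eq_map, Multiset.card_map, Finset.card_univ, Fintype.card_fun,
    Fintype.card_coe, ZMod.card]
  rfl

lemma hasOddCycles_iff {m : ℕ} (σ : Equiv.Perm (Fin (m + 1))) :
    HasOddCycles σ ↔ ∀ c ∈ rauzyRank σ ::ₘ rauzyLambda σ, ¬ Even c := by
  have hr : rauzyRank σ = cycleLength (cycleMap σ) 0 - 1 := rfl
  have hp := cycleLength_pos (cycleMap σ) 0
  have hrank : ¬ Even (rauzyRank σ) ↔ Even (cycleLength (cycleMap σ) 0) := by
    rw [hr, Nat.even_sub hp]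
    simp
  have hodd : ∀ k : ℕ, (-(-1) ^ k : ℤˣ) = 1 ↔ ¬ Even k := by
    intro k
    rcases Nat.even_or_odd k with h | h
    · simp [h]
    · simp [h]
  have heven : ∀ k : ℕ, (-(-1) ^ k : ℤˣ) = -1 ↔ Even k := by
    intro k
    rcases Nat.even_or_odd k with h | h
    · simp [h]
    · simp [h]
  simp only [Multiset.mem_cons, forall_eq_or_imp, rauzyLambda_eq_map, Multiset.mem_map,
    Finset.mem_val, forall_exists_index, and_imp, forall_apply_eq_imp_iff₂, hrank, HasOddCycles,
    sign_cycleOf]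
  refine ⟨fun h => ⟨?_, fun j hj => ?_⟩, fun ⟨h1, h2⟩ j => ?_⟩
  · have := h 0
    rwa [if_pos (Equiv.Perm.SameCycle.refl _ _), heven] at this
  · have := h j
    rwa [if_neg fun h' => (mem_closedCycles.1 hj).2 h'.symm, hodd] at this
  · by_cases hj : (cycleMap σ).SameCycle j 0
    · rwa [if_pos hj, heven, cycleLength_congr hj]
    · rw [if_neg hj, hodd, cycleLength_congr (sameCycle_cycleMin (cycleMap σ) j)]
      exact h2 _ (cycleMin_mem_closedCycles fun h' => hj h'.symm)

lemma rauzyIrreducible.apply_zero_ne_last {m : ℕ} {σ : Equiv.Perm (Fin (m + 1))}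
    (hσ : rauzyIrreducible σ) (hm : 1 ≤ m) : σ 0 ≠ Fin.last m := by
  intro h
  refine hσ 1 le_rfl (by omega) ?_
  have h1 : (Finset.univ.filter fun j : Fin (m + 1) => j.val < 1) = {0} := by
    ext j
    simp only [Finset.mem_filter, Finset.mem_univ, true_and, Finset.mem_singleton, Fin.ext_iff,
      Fin.val_zero, Nat.lt_one_iff]
  have h2 : (Finset.univ.filter fun j : Fin (m + 1) => m + 1 - 1 ≤ j.val) = {Fin.last m} := by
    ext j
    have := j.isLt
    simp only [Finset.mem_filter, Finset.mem_univ, true_and, Finset.mem_singleton, Fin.ext_iff,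
      Fin.val_last]
    omega
  rw [h1, h2, Finset.image_singleton, h]

lemma eq_or_eq_neg_of_sq_eq_two_pow {a : ℤ} {k : ℕ} (h : a ^ 2 = 2 ^ k) :
    Even k ∧ (a = 2 ^ (k / 2) ∨ a = -(2 ^ (k / 2))) := by
  have hnat : a.natAbs ^ 2 = 2 ^ k := by
    have := congrArg Int.natAbs h
    rwa [Int.natAbs_pow, Int.natAbs_pow] at this
  obtain ⟨b, -, hb⟩ := (Nat.dvd_prime_pow Nat.prime_two).1
    (Dvd.intro_left _ ((pow_two _).symm.trans hnat))
  rw [hb, ← pow_mul] at hnat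
  have hk : b * 2 = k := Nat.pow_right_injective le_rfl hnat
  subst hk
  refine ⟨even_two.mul_left b, ?_⟩
  rw [Nat.mul_div_cancel _ two_pos]
  have h2 := Int.natAbs_eq a
  rwa [hb, Nat.cast_pow, Nat.cast_ofNat] at h2

/-- If some entry of `λ ∪ {r}` is even then `Ā(σ) = 0` (so `s(σ) = 0`); if all entries are
odd then `n + ℓ` is even and `Ā(σ) = ±2^{(n+ℓ)/2}` (so `s(σ) = ±1`). -/
theorem arf_value_theorem {n : ℕ} (hn : 2 ≤ n) (σ : Equiv.Perm (Fin n))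
    (hσ : rauzyIrreducible σ) :
    ((∃ c ∈ rauzyRank σ ::ₘ rauzyLambda σ, Even c) → arfBar σ = 0 ∧ arfSign σ = 0) ∧
    ((∀ c ∈ rauzyRank σ ::ₘ rauzyLambda σ, ¬ Even c) →
      Even (n + Multiset.card (rauzyLambda σ)) ∧
      (arfBar σ = 2 ^ ((n + Multiset.card (rauzyLambda σ)) / 2) ∨
        arfBar σ = -(2 ^ ((n + Multiset.card (rauzyLambda σ)) / 2))) ∧
      (arfSign σ = 1 ∨ arfSign σ = -1)) := by
  obtain ⟨m, rfl⟩ := Nat.exists_eq_succ_of_ne_zero (by omega : n ≠ 0)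
  have h0 := hσ.apply_zero_ne_last (by omega)
  rw [← hasOddCycles_iff]
  refine ⟨fun ⟨c, hc, hce⟩ => ?_, fun h => ?_⟩
  · have hne : ¬ HasOddCycles σ := fun h => (hasOddCycles_iff σ).1 h c hc hce
    obtain ⟨u, hu, hq⟩ : ∃ u ∈ arfRadical σ, arfForm σ u ≠ 0 := by
      by_contra! h
      exact hne (hasOddCycles_of_forall_arfForm_eq_zero h0 h)
    have h := arfBar_eq_zero_of_arfForm_ne_zero hu hq
    exact ⟨h, by rw [arfSign, h, Int.sign_zero]⟩
  · have hsq := arfBar_sq_of_arfForm_eq_zero fun u hu => h.arfForm_eq_zero h0 hu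
    rw [card_arfRadical h0, Nat.cast_pow, Nat.cast_ofNat, ← pow_add] at hsq
    obtain ⟨he, hv⟩ := eq_or_eq_neg_of_sq_eq_two_pow hsq
    refine ⟨he, hv, ?_⟩
    rcases hv with hv | hv
    · exact Or.inl (by rw [arfSign, hv, Int.sign_eq_one_of_pos (by positivity)])
    · exact Or.inr (by rw [arfSign, hv, Int.sign_neg, Int.sign_eq_one_of_pos (by positivity)])

end Rauzy
end

section
/- Let n ≥ 9, let λ be a multiset of odd integers each at least 3, and let r ≥ 1 be an odd integer with r + Σ_{c∈λ} c = n − 1. Then there exist irreducible permutations σ₊ and σ₋ of {1,…,n}, both with cycle invariant (λ, r), such that Ā(σ₊) > 0 and Ā(σ₋) < 0; consequently σ₊ and σ₋ are not connected. -/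
open scoped Classical

namespace Rauzy

/-- The initial block `{0,…,i-1}` of `Fin n` as a subtype. -/
def blockEquiv (n i : ℕ) (h : i ≤ n) : Fin i ≃ {j : Fin n // j.val < i} where
  toFun x := ⟨⟨x.val, lt_of_lt_of_le x.isLt h⟩, x.isLt⟩
  invFun x := ⟨x.1.val, x.2⟩
  left_inv _ := rfl
  right_inv _ := rfl

/-- The final block `{a,…,n-1}` of `Fin n` as a subtype. -/
def tailEquiv (n a : ℕ) (h : a ≤ n) : Fin (n - a) ≃ {j : Fin n // a ≤ j.val} where
  toFun x := ⟨⟨a + x.val, by have := x.isLt; omega⟩, by simp⟩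
  invFun x := ⟨x.1.val - a, by have := x.1.isLt; have := x.2; omega⟩
  left_inv x := by apply Fin.ext; simp
  right_inv x := by apply Subtype.ext; apply Fin.ext; have := x.2; simp; omega

/-- Cyclically rotate the first `i` elements of `Fin n` down by one
(`0 ↦ i-1`, `j ↦ j-1` for `1 ≤ j ≤ i-1`), fixing the others. -/
def rotDownBelow (n i : ℕ) (h : i ≤ n) : Equiv.Perm (Fin n) :=
  Equiv.Perm.extendDomain (finRotate i)⁻¹ (blockEquiv n i h)

/-- Cyclically rotate the last `n - a` elements of `Fin n` down by one
(`a ↦ n-1`, `j ↦ j-1` for `a+1 ≤ j ≤ n-1`), fixing the others. -/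
def rotDownFrom (n a : ℕ) (h : a ≤ n) : Equiv.Perm (Fin n) :=
  Equiv.Perm.extendDomain (finRotate (n - a))⁻¹ (tailEquiv n a h)

/-- The Rauzy operator `L`: `L(σ) = γ_L(σ(n)) ∘ σ`. -/
def rauzyL {n : ℕ} (σ : Equiv.Perm (Fin n)) : Equiv.Perm (Fin n) :=
  if h : 0 < n then
    rotDownBelow n (σ ⟨n - 1, by omega⟩).val (σ ⟨n - 1, by omega⟩).isLt.le * σ
  else σ

/-- The Rauzy operator `R`: `R(σ) = σ ∘ δ_R(σ⁻¹(1))`. -/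
def rauzyR {n : ℕ} (σ : Equiv.Perm (Fin n)) : Equiv.Perm (Fin n) :=
  if h : 0 < n then σ * rotDownFrom n ((σ⁻¹ ⟨0, h⟩).val + 1) (σ⁻¹ ⟨0, h⟩).isLt
  else σ

/-- One step of the Rauzy dynamics: apply `L` or `R`. -/
def rauzyStep {n : ℕ} (σ τ : Equiv.Perm (Fin n)) : Prop :=
  τ = rauzyL σ ∨ τ = rauzyR σ

/-- `τ` is obtained from `σ` by a finite sequence of applications of `L` and `R`. -/
def rauzyReach {n : ℕ} (σ τ : Equiv.Perm (Fin n)) : Prop :=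
  Relation.ReflTransGen rauzyStep σ τ

/-- Two permutations are connected (are in the same Rauzy class) if one can be obtained
from the other by a finite sequence of applications of `L` and `R`. -/
def rauzyConnected {n : ℕ} (σ τ : Equiv.Perm (Fin n)) : Prop :=
  rauzyReach σ τ ∨ rauzyReach τ σ

/-- The number of pairs of `I` in the relation `P`. -/
noncomputable def pairCount {ι : Type*} (P : ι → ι → Prop) (I : Finset ι) : ℕ :=
  ((I ×ˢ I).filter fun pr => P pr.1 pr.2).card

/-- The Arf-type sum attached to the relation `P`. -/
noncomputable def arfSum {ι : Type*} [Fintype ι] (P : ι → ι → Prop) : ℤ :=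
  ∑ I : Finset ι, (-1 : ℤ) ^ (I.card + pairCount P I)

theorem chiSet_eq_pairCount {n : ℕ} (σ : Equiv.Perm (Fin n)) (I : Finset (Fin n)) :
    chiSet σ I = pairCount (fun i j => i < j ∧ σ i < σ j) I := by
  unfold chiSet pairCount
  congr

theorem arfBar_eq_arfSum {n : ℕ} (σ : Equiv.Perm (Fin n)) :
    arfBar σ = arfSum (fun i j => i < j ∧ σ i < σ j) := by
  simp only [arfBar, arfSum, chiSet_eq_pairCount]

theorem pairCount_insert {ι : Type*} [DecidableEq ι] {P : ι → ι → Prop}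
    (hP : ∀ x y, P x y → ¬ P y x)
    {a : ι} {I : Finset ι} (ha : a ∉ I) :
    pairCount P (insert a I) = pairCount P I + (I.filter fun y => P a y ∨ P y a).card := by
  have haa : ¬ P a a := fun h => hP a a h h
  have key : ((insert a I ×ˢ insert a I).filter fun pr => P pr.1 pr.2) =
      ((I ×ˢ I).filter fun pr => P pr.1 pr.2) ∪
        ((I.filter fun y => P a y).image (fun y => (a, y)) ∪
          (I.filter fun y => P y a).image (fun y => (y, a))) := by
    ext ⟨x, y⟩
    simp only [Finset.mem_filter, Finset.mem_product, Finset.mem_insert, Finset.mem_union,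
      Finset.mem_image, Prod.mk.injEq]
    constructor
    · rintro ⟨⟨rfl | hx, rfl | hy⟩, h⟩
      · exact absurd h haa
      · exact Or.inr (Or.inl ⟨y, ⟨hy, h⟩, rfl, rfl⟩)
      · exact Or.inr (Or.inr ⟨x, ⟨hx, h⟩, rfl, rfl⟩)
      · exact Or.inl ⟨⟨hx, hy⟩, h⟩
    · rintro (⟨⟨hx, hy⟩, h⟩ | ⟨z, ⟨hz, h⟩, rfl, rfl⟩ | ⟨z, ⟨hz, h⟩, rfl, rfl⟩)
      · exact ⟨⟨Or.inr hx, Or.inr hy⟩, h⟩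
      · exact ⟨⟨Or.inl rfl, Or.inr hz⟩, h⟩
      · exact ⟨⟨Or.inr hz, Or.inl rfl⟩, h⟩
  unfold pairCount
  rw [key, Finset.card_union_of_disjoint, Finset.card_union_of_disjoint,
    Finset.card_image_of_injective _ (fun x y h => (Prod.mk.inj h).2),
    Finset.card_image_of_injective _ (fun x y h => (Prod.mk.inj h).1), Finset.filter_or,
    Finset.card_union_of_disjoint]
  · rw [Finset.disjoint_left]
    intro x hx hx'
    exact hP _ _ (Finset.mem_filter.1 hx).2 (Finset.mem_filter.1 hx').2
  · rw [Finset.disjoint_left]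
    rintro ⟨x, y⟩ hx hx'
    simp only [Finset.mem_filter, Finset.mem_image, Prod.mk.injEq] at hx hx'
    grind
  · rw [Finset.disjoint_left]
    rintro ⟨x, y⟩ hx hx'
    simp only [Finset.mem_filter, Finset.mem_image, Finset.mem_union, Finset.mem_product,
      Prod.mk.injEq] at hx hx'
    grind

theorem pairCount_congr {ι : Type*} {P P' : ι → ι → Prop} (hP : ∀ x y, P x y → ¬ P y x)
    (hP' : ∀ x y, P' x y → ¬ P' y x) {I : Finset ι}
    (h : ∀ x ∈ I, ∀ y ∈ I, x ≠ y → ((P x y ∨ P y x) ↔ (P' x y ∨ P' y x))) :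
    pairCount P I = pairCount P' I := by
  induction I using Finset.induction_on with
  | empty => simp [pairCount]
  | insert a I ha ih =>
    rw [pairCount_insert hP ha, pairCount_insert hP' ha, ih]
    · congr 2
      apply Finset.filter_congr
      intro y hy
      exact h a (Finset.mem_insert_self _ _) y (Finset.mem_insert_of_mem hy)
        (fun e => ha (e ▸ hy))
    · intro x hx y hy
      exact h x (Finset.mem_insert_of_mem hx) y (Finset.mem_insert_of_mem hy)

theorem card_filter_xor_mod_two {ι : Type*} (I : Finset ι) (p q r : ι → Prop)
    (h : ∀ y ∈ I, (r y ↔ ¬ (p y ↔ q y))) :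
    ((I.filter p).card + (I.filter q).card + (I.filter r).card) % 2 = 0 := by
  induction I using Finset.induction_on with
  | empty => simp
  | insert a I ha ih =>
    have ih := ih fun y hy => h y (Finset.mem_insert_of_mem hy)
    have h1 := h a (Finset.mem_insert_self _ _)
    simp only [Finset.filter_insert]
    have hn : ∀ s : ι → Prop, a ∉ I.filter s := fun s hs => ha (Finset.mem_filter.1 hs).1
    by_cases hp : p a <;> by_cases hq : q a <;> simp only [hp, hq] at h1 <;>
      simp [hp, hq, h1, hn] <;> omega

theorem sum_finset_split_pair {ι : Type*} [Fintype ι] {e g : ι} (heg : e ≠ g)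
    (F : Finset ι → ℤ) :
    ∑ I : Finset ι, F I =
      ∑ I ∈ ((Finset.univ.erase g).erase e).powerset,
        (F I + F (insert e I) + F (insert g I) + F (insert e (insert g I))) := by
  have h1 : (Finset.univ : Finset ι) = insert g (insert e ((Finset.univ.erase g).erase e)) := by
    rw [Finset.insert_erase (by simp [heg]), Finset.insert_erase (by simp)]
  rw [← Finset.powerset_univ]
  conv_lhs => rw [h1]
  rw [Finset.sum_powerset_insert (by simp [heg.symm]), Finset.sum_powerset_insert (by simp),
    Finset.sum_powerset_insert (by simp), ← Finset.sum_add_distrib, ← Finset.sum_add_distrib,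
    ← Finset.sum_add_distrib]
  refine Finset.sum_congr rfl fun I _ => ?_
  rw [Finset.insert_comm g e]
  ring

/-- Adding the edge `g` to the edge `e` in the quadratic form does not change the Arf sum. -/
theorem arfSum_eq_of_transvection {ι : Type*} [Fintype ι] {P P' : ι → ι → Prop}
    (hP : ∀ x y, P x y → ¬ P y x) (hP' : ∀ x y, P' x y → ¬ P' y x) {e g : ι} (heg : e ≠ g)
    (h1 : P e g ∨ P g e) (h1' : P' e g ∨ P' g e)
    (h2 : ∀ x y, x ≠ e → y ≠ e → x ≠ y → ((P x y ∨ P y x) ↔ (P' x y ∨ P' y x)))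
    (h3 : ∀ y, y ≠ e → y ≠ g →
      ((P' e y ∨ P' y e) ↔ ¬ ((P e y ∨ P y e) ↔ (P g y ∨ P y g)))) :
    arfSum P = arfSum P' := by
  unfold arfSum
  rw [sum_finset_split_pair heg, sum_finset_split_pair heg]
  refine Finset.sum_congr rfl fun I hI => ?_
  rw [Finset.mem_powerset] at hI
  have heI : e ∉ I := fun h => by simpa using hI h
  have hgI : g ∉ I := fun h => by simpa using hI h
  have hmem : ∀ y ∈ I, y ≠ e ∧ y ≠ g := fun y hy =>
    ⟨fun h => heI (h ▸ hy), fun h => hgI (h ▸ hy)⟩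
  have heg' : e ∉ insert g I := by simp [heg, heI]
  have c0 : pairCount P' I = pairCount P I :=
    (pairCount_congr hP hP' fun x hx y hy hxy =>
      h2 x y (hmem x hx).1 (hmem y hy).1 hxy).symm
  have cg : (I.filter fun y => P' g y ∨ P' y g).card = (I.filter fun y => P g y ∨ P y g).card := by
    congr 1
    apply Finset.filter_congr
    intro y hy
    exact (h2 g y heg.symm (hmem y hy).1 (hmem y hy).2.symm).symm
  have ce : ((I.filter fun y => P e y ∨ P y e).card + (I.filter fun y => P g y ∨ P y g).card +
      (I.filter fun y => P' e y ∨ P' y e).card) % 2 = 0 := by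
    convert card_filter_xor_mod_two I (fun y => P e y ∨ P y e) (fun y => P g y ∨ P y g)
      (fun y => P' e y ∨ P' y e) fun y hy => h3 y (hmem y hy).1 (hmem y hy).2
  rw [pairCount_insert hP heg', pairCount_insert hP' heg', pairCount_insert hP heI,
    pairCount_insert hP' heI, pairCount_insert hP hgI, pairCount_insert hP' hgI,
    Finset.card_insert_of_notMem heg', Finset.card_insert_of_notMem heI,
    Finset.card_insert_of_notMem hgI, Finset.filter_insert, Finset.filter_insert,
    if_pos h1, if_pos h1', Finset.card_insert_of_notMem (by simp [hgI]),
    Finset.card_insert_of_notMem (by simp [hgI]), c0, cg]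
  generalize (I.filter fun y => P e y ∨ P y e).card = a at *
  generalize (I.filter fun y => P g y ∨ P y g).card = b at *
  generalize (I.filter fun y => P' e y ∨ P' y e).card = c at *
  generalize pairCount P I = q
  have hpow : ∀ i j : ℕ, i % 2 = j % 2 → (-1 : ℤ) ^ i = (-1) ^ j := fun i j h => by
    rw [neg_one_pow_eq_pow_mod_two, h, ← neg_one_pow_eq_pow_mod_two]
  rw [hpow (I.card + 1 + (q + c)) (I.card + 1 + 1 + (q + b + (a + 1))) (by omega),
    hpow (I.card + 1 + 1 + (q + b + (c + 1))) (I.card + 1 + (q + a)) (by omega)]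
  ring

theorem arfSum_comp_equiv {ι κ : Type*} [Fintype ι] [Fintype κ] (φ : ι ≃ κ)
    (P : κ → κ → Prop) : arfSum (fun x y => P (φ x) (φ y)) = arfSum P := by
  unfold arfSum
  refine Fintype.sum_equiv (Equiv.finsetCongr φ) _ _ fun I => ?_
  have : pairCount P (I.map φ.toEmbedding) = pairCount (fun x y => P (φ x) (φ y)) I := by
    unfold pairCount
    rw [← Finset.card_map (φ.toEmbedding.prodMap φ.toEmbedding)]
    congr 1
    ext ⟨x, y⟩
    simp only [Finset.mem_filter, Finset.mem_product, Finset.mem_map, Prod.exists]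
    constructor
    · rintro ⟨⟨⟨x, hx, rfl⟩, ⟨y, hy, rfl⟩⟩, h⟩
      exact ⟨x, y, ⟨⟨hx, hy⟩, h⟩, rfl⟩
    · rintro ⟨x', y', ⟨⟨hx, hy⟩, h⟩, he⟩
      obtain ⟨rfl, rfl⟩ := Prod.mk.inj he
      exact ⟨⟨⟨x', hx, rfl⟩, ⟨y', hy, rfl⟩⟩, h⟩
  simp [Equiv.finsetCongr, this]

theorem val_finRotate_inv {k : ℕ} (x : Fin k) :
    ((finRotate k)⁻¹ x).val = if x.val = 0 then k - 1 else x.val - 1 := by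
  obtain ⟨y, rfl⟩ := (finRotate k).surjective x
  rw [Equiv.Perm.inv_def, Equiv.symm_apply_apply]
  cases k with
  | zero => exact y.elim0
  | succ k =>
    rw [finRotate_apply, Fin.val_add_one]
    have := y.isLt
    by_cases h : y = Fin.last k
    · simp [h]
    · simp [h]

theorem val_rotDownBelow {n i : ℕ} (h : i ≤ n) (x : Fin n) :
    (rotDownBelow n i h x).val =
      if x.val < i then (if x.val = 0 then i - 1 else x.val - 1) else x.val := by
  unfold rotDownBelow
  split_ifs with h1 h2
  · rw [Equiv.Perm.extendDomain_apply_subtype (p := fun j : Fin n => j.val < i) _ _ h1]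
    change ((finRotate i)⁻¹ _).val = _
    rw [val_finRotate_inv]
    simp [blockEquiv, h2]
  · rw [Equiv.Perm.extendDomain_apply_subtype (p := fun j : Fin n => j.val < i) _ _ h1]
    change ((finRotate i)⁻¹ _).val = _
    rw [val_finRotate_inv]
    simp [blockEquiv, h2]
  · rw [Equiv.Perm.extendDomain_apply_not_subtype (p := fun j : Fin n => j.val < i) _ _ h1]

theorem val_rotDownFrom {n a : ℕ} (h : a ≤ n) (x : Fin n) :
    (rotDownFrom n a h x).val =
      if a ≤ x.val then (if x.val = a then n - 1 else x.val - 1) else x.val := by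
  have hx := x.isLt
  unfold rotDownFrom
  split_ifs with h1 h2
  · rw [Equiv.Perm.extendDomain_apply_subtype (p := fun j : Fin n => a ≤ j.val) _ _ h1]
    change a + ((finRotate (n - a))⁻¹ _).val = _
    rw [val_finRotate_inv]
    simp [tailEquiv, h2]
    omega
  · rw [Equiv.Perm.extendDomain_apply_subtype (p := fun j : Fin n => a ≤ j.val) _ _ h1]
    have : x.val - a ≠ 0 := by omega
    change a + ((finRotate (n - a))⁻¹ _).val = _
    rw [val_finRotate_inv]
    simp [tailEquiv, this]
    omega
  · rw [Equiv.Perm.extendDomain_apply_not_subtype (p := fun j : Fin n => a ≤ j.val) _ _ h1]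

theorem arfBar_rauzyL {n : ℕ} (σ : Equiv.Perm (Fin n)) : arfBar (rauzyL σ) = arfBar σ := by
  rcases Nat.eq_zero_or_pos n with rfl | hn
  · simp [rauzyL]
  have hval : ∀ x, (rauzyL σ x).val = if (σ x).val < (σ ⟨n - 1, by omega⟩).val then
      (if (σ x).val = 0 then (σ ⟨n - 1, by omega⟩).val - 1 else (σ x).val - 1)
      else (σ x).val := fun x => by
    simp only [rauzyL, dif_pos hn, Equiv.Perm.mul_apply, val_rotDownBelow]
  set g : Fin n := ⟨n - 1, by omega⟩ with hg
  set e : Fin n := σ⁻¹ ⟨0, hn⟩ with he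
  have hσe : (σ e).val = 0 := by simp [he]
  have hinj : ∀ x y : Fin n, x ≠ y → (σ x).val ≠ (σ y).val := fun x y h h' =>
    h (σ.injective (Fin.ext h'))
  have hlast : ∀ x : Fin n, x ≠ g → x.val < g.val := fun x h => by
    have : x.val ≠ g.val := fun h' => h (Fin.ext h')
    have := x.isLt
    simp only [hg] at *
    omega
  rw [arfBar_eq_arfSum, arfBar_eq_arfSum]
  simp only [Fin.lt_def]
  by_cases heg : e = g
  · have h0 : (σ g).val = 0 := heg ▸ hσe
    simp only [hval, h0, Nat.not_lt_zero, if_false]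
  have hpos : 0 < (σ g).val := by have := hinj e g heg; omega
  symm
  refine arfSum_eq_of_transvection (e := e) (g := g) (fun x y h h' => by omega)
    (fun x y h h' => by omega) heg ?_ ?_ ?_ ?_
  · have := hlast e heg; omega
  · have := hlast e heg
    left
    refine ⟨this, ?_⟩
    rw [hval, hval, if_pos (by omega), if_pos hσe, if_neg (by omega)]
    omega
  · intro x y hx hy hxy
    have hx0 := hinj x e hx
    have hy0 := hinj y e hy
    have := hinj x y hxy
    have e1 := hval x
    have e2 := hval y
    have h4 : x ≠ g → (σ x).val ≠ (σ g).val := hinj x g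
    have h5 : y ≠ g → (σ y).val ≠ (σ g).val := hinj y g
    split_ifs at e1 e2 <;> omega
  · intro y hy hyg
    have hy0 := hinj y e hy
    have h5 := hinj y g hyg
    have h6 := hlast y hyg
    have h7 := hlast e heg
    have h8 : y.val ≠ e.val := fun h => hy (Fin.ext h)
    have e1 := hval e
    have e2 := hval y
    rw [if_pos (by omega), if_pos hσe] at e1
    split_ifs at e2 <;> omega

theorem arfBar_rauzyR {n : ℕ} (σ : Equiv.Perm (Fin n)) : arfBar (rauzyR σ) = arfBar σ := by
  rcases Nat.eq_zero_or_pos n with rfl | hn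
  · simp [rauzyR]
  set g : Fin n := σ⁻¹ ⟨0, hn⟩ with hg
  set δ := rotDownFrom n (g.val + 1) g.isLt with hδ
  have hR : rauzyR σ = σ * δ := by simp only [rauzyR, dif_pos hn, ← hg, hδ]
  have hval : ∀ x, (δ x).val = if g.val + 1 ≤ x.val then
      (if x.val = g.val + 1 then n - 1 else x.val - 1) else x.val := fun x =>
    val_rotDownFrom _ x
  have hσg : (σ g).val = 0 := by simp [hg]
  have hinj : ∀ x y : Fin n, x ≠ y → (σ x).val ≠ (σ y).val := fun x y h h' =>
    h (σ.injective (Fin.ext h'))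
  rw [arfBar_eq_arfSum, arfBar_eq_arfSum, hR]
  rw [← arfSum_comp_equiv δ.symm]
  simp only [Equiv.Perm.mul_apply, Equiv.apply_symm_apply, Fin.lt_def]
  set u := fun x : Fin n => (δ.symm x).val with hu
  set e : Fin n := ⟨n - 1, by omega⟩ with he
  have hval' : ∀ x, x.val = if g.val + 1 ≤ u x then
      (if u x = g.val + 1 then n - 1 else u x - 1) else u x := fun x => by
    have := hval (δ.symm x)
    rwa [Equiv.apply_symm_apply] at this
  have hun : ∀ x, u x < n := fun x => (δ.symm x).isLt
  have hev : e.val = n - 1 := rfl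
  change arfSum (fun x y => u x < u y ∧ _) = _
  by_cases heg : e = g
  · have : ∀ x, u x = x.val := fun x => by
      have h1 := hval' x
      have h2 := hun x
      rw [← heg] at h1
      split_ifs at h1 <;> omega
    simp only [this]
  have hlt : ∀ x : Fin n, x ≠ e → x.val < n - 1 := fun x h => by
    have : x.val ≠ e.val := fun h' => h (Fin.ext h')
    have := x.isLt
    omega
  have hgl := hlt g (Ne.symm heg)
  have hue : u e = g.val + 1 := by
    have h1 := hval' e
    have h2 := hun e
    split_ifs at h1 <;> omega
  have hux : ∀ x : Fin n, x ≠ e → u x = if x.val ≤ g.val then x.val else x.val + 1 := by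
    intro x hx
    have h1 := hval' x
    have h2 := hlt x hx
    split_ifs at h1 ⊢ <;> omega
  symm
  have hug := hux g (Ne.symm heg)
  rw [if_pos le_rfl] at hug
  refine arfSum_eq_of_transvection (e := e) (g := g) (fun x y h h' => by omega)
    (fun x y h h' => by omega) heg ?_ ?_ ?_ ?_
  · have := hinj e g heg; omega
  · have := hinj e g heg
    omega
  · intro x y hx hy hxy
    have e1 := hux x hx
    have e2 := hux y hy
    have := hinj x y hxy
    split_ifs at e1 e2 <;> omega
  · intro y hy hyg
    have e1 := hux y hy
    have h1 := hinj y g hyg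
    have h2 := hinj y e hy
    have h3 := hlt y hy
    have h4 : y.val ≠ g.val := fun h => hyg (Fin.ext h)
    split_ifs at e1 <;> omega

theorem arfBar_eq_of_rauzyReach {n : ℕ} {σ τ : Equiv.Perm (Fin n)} (h : rauzyReach σ τ) :
    arfBar τ = arfBar σ := by
  induction h with
  | refl => rfl
  | tail _ hs ih =>
    rcases hs with rfl | rfl
    · rw [arfBar_rauzyL, ih]
    · rw [arfBar_rauzyR, ih]

theorem arfBar_eq_of_rauzyConnected {n : ℕ} {σ τ : Equiv.Perm (Fin n)}
    (h : rauzyConnected σ τ) : arfBar σ = arfBar τ :=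
  h.elim (fun h => (arfBar_eq_of_rauzyReach h).symm) arfBar_eq_of_rauzyReach

/-- The number of pairs of positions of `w` at which `w` increases. -/
def ascPairs : List ℕ → ℕ
  | [] => 0
  | a :: l => l.countP (fun b => a < b) + ascPairs l

/-- The sum of `x ^ |l| * (-1) ^ (ascPairs l)` over the sublists `l` of `w`. -/
def ascSum (x : ℤ) (w : List ℕ) : ℤ :=
  (w.sublists.map fun l => x ^ l.length * (-1) ^ ascPairs l).sum

theorem ascSum_eq_sublists' (x : ℤ) (w : List ℕ) :
    ascSum x w = (w.sublists'.map fun l => x ^ l.length * (-1) ^ ascPairs l).sum :=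
  ((List.sublists_perm_sublists' w).map _).sum_eq

theorem ascPairs_concat (l : List ℕ) (a : ℕ) :
    ascPairs (l ++ [a]) = ascPairs l + l.countP (fun b => b < a) := by
  induction l with
  | nil => simp [ascPairs]
  | cons b l ih =>
    simp only [List.cons_append, ascPairs, ih, List.countP_append, List.countP_cons,
      List.countP_nil]
    omega

theorem ascPairs_map {f : ℕ → ℕ} (hf : StrictMono f) (l : List ℕ) :
    ascPairs (l.map f) = ascPairs l := by
  induction l with
  | nil => rfl
  | cons b l ih => simp [ascPairs, ih, List.countP_map, Function.comp_def, hf.lt_iff_lt]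

theorem ascSum_map {f : ℕ → ℕ} (hf : StrictMono f) (x : ℤ) (w : List ℕ) :
    ascSum x (w.map f) = ascSum x w := by
  simp [ascSum, List.sublists_map, Function.comp_def, ascPairs_map hf]

theorem ascSum_cons_of_forall_lt (x : ℤ) {a : ℕ} {w : List ℕ} (h : ∀ b ∈ w, b < a) :
    ascSum x (a :: w) = (1 + x) * ascSum x w := by
  simp only [ascSum_eq_sublists', List.sublists'_cons, List.map_append, List.sum_append,
    List.map_map]
  rw [one_add_mul, ← List.sum_map_mul_left]
  congr 2
  apply List.map_congr_left
  intro l hl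
  have : l.countP (fun b => a < b) = 0 := by
    rw [List.countP_eq_zero]
    intro b hb
    have := h b ((List.mem_sublists'.1 hl).subset hb)
    simp; omega
  simp [ascPairs, this]
  ring

theorem ascSum_cons_of_forall_gt (x : ℤ) {a : ℕ} {w : List ℕ} (h : ∀ b ∈ w, a < b) :
    ascSum x (a :: w) = ascSum x w + x * ascSum (-x) w := by
  simp only [ascSum_eq_sublists', List.sublists'_cons, List.map_append, List.sum_append,
    List.map_map]
  rw [← List.sum_map_mul_left]
  congr 2
  apply List.map_congr_left
  intro l hl
  have : l.countP (fun b => a < b) = l.length := by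
    rw [List.countP_eq_length]
    intro b hb
    simpa using h b ((List.mem_sublists'.1 hl).subset hb)
  simp [ascPairs, this, neg_pow x]
  ring

theorem ascSum_concat_of_forall_gt (x : ℤ) {a : ℕ} {w : List ℕ} (h : ∀ b ∈ w, a < b) :
    ascSum x (w ++ [a]) = (1 + x) * ascSum x w := by
  simp only [ascSum, List.sublists_concat, List.map_append, List.sum_append, List.map_map]
  rw [one_add_mul, ← List.sum_map_mul_left]
  congr 2
  apply List.map_congr_left
  intro l hl
  have : l.countP (fun b => b < a) = 0 := by
    rw [List.countP_eq_zero]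
    intro b hb
    have := h b ((List.mem_sublists.1 hl).subset hb)
    simp; omega
  simp [ascPairs_concat, this]
  ring

theorem ascSum_concat_of_forall_lt (x : ℤ) {a : ℕ} {w : List ℕ} (h : ∀ b ∈ w, b < a) :
    ascSum x (w ++ [a]) = ascSum x w + x * ascSum (-x) w := by
  simp only [ascSum, List.sublists_concat, List.map_append, List.sum_append, List.map_map]
  rw [← List.sum_map_mul_left]
  congr 2
  apply List.map_congr_left
  intro l hl
  have : l.countP (fun b => b < a) = l.length := by
    rw [List.countP_eq_length]
    intro b hb
    simpa using h b ((List.mem_sublists.1 hl).subset hb)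
  simp [ascPairs_concat, this, neg_pow x]
  ring

theorem pairCount_toFinset_eq_ascPairs {n : ℕ} (f : Fin n → ℕ) {l : List (Fin n)}
    (hl : l.Pairwise (· < ·)) :
    pairCount (fun i j => i < j ∧ f i < f j) l.toFinset = ascPairs (l.map f) := by
  induction l with
  | nil => simp [pairCount, ascPairs]
  | cons a l ih =>
    obtain ⟨h1, h2⟩ := List.pairwise_cons.1 hl
    have ha : a ∉ l.toFinset := fun h => lt_irrefl a (h1 a (List.mem_toFinset.1 h))
    rw [List.toFinset_cons, pairCount_insert (fun x y h h' => by omega) ha, ih h2, List.map_cons,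
      ascPairs, add_comm, List.countP_map, List.countP_eq_length_filter]
    congr 1
    rw [← List.toFinset_card_of_nodup ((h2.imp ne_of_lt).filter _)]
    congr 1
    ext y
    simp only [Finset.mem_filter, List.mem_toFinset, List.mem_filter, Function.comp_apply,
      decide_eq_true_eq]
    refine and_congr_right fun hy => ?_
    have := h1 y hy
    constructor
    · rintro (h | h) <;> omega
    · intro h
      exact Or.inl ⟨this, h⟩

theorem arfBar_eq_ascSum {n : ℕ} (σ : Equiv.Perm (Fin n)) :
    arfBar σ = ascSum (-1) ((List.finRange n).map fun i => (σ i).val) := by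
  have key : ∀ F : Finset (Fin n) → ℤ, ∑ I : Finset (Fin n), F I =
      ((List.finRange n).sublists.map fun l => F l.toFinset).sum := fun F => by
    rw [← List.sum_toFinset _ (List.nodup_sublists.2 (List.nodup_finRange n))]
    symm
    refine Finset.sum_bij (fun l _ => l.toFinset) (fun _ _ => Finset.mem_univ _) ?_ ?_
      (fun _ _ => rfl)
    · intro l hl l' hl' h
      simp only [List.mem_toFinset, List.mem_sublists] at hl hl'
      have s := (List.sortedLT_finRange n).pairwise
      exact (List.perm_of_nodup_nodup_toFinset_eq ((s.sublist hl).imp ne_of_lt)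
        ((s.sublist hl').imp ne_of_lt) h).eq_of_pairwise
          (fun a b _ _ h h' => by omega) (s.sublist hl) (s.sublist hl')
    · intro I _
      refine ⟨(List.finRange n).filter (· ∈ I), ?_, ?_⟩
      · simp
      · ext x; simp
  rw [arfBar_eq_arfSum, arfSum, key, ascSum, List.sublists_map, List.map_map]
  congr 1
  apply List.map_congr_left
  intro l hl
  have s : l.Pairwise (· < ·) :=
    (List.sortedLT_finRange n).pairwise.sublist (List.mem_sublists.1 hl)
  have := pairCount_toFinset_eq_ascPairs (fun i => (σ i).val) s
  simp only [Fin.lt_def] at this ⊢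
  rw [this, List.toFinset_card_of_nodup (s.imp ne_of_lt)]
  simp [pow_add]

/-- The nonempty list `l` is, read cyclically, a chain for the relation `r`. -/
def IsCyclicChain {α : Type*} (r : α → α → Prop) (l : List α) : Prop :=
  ∃ a t, l = a :: t ∧ (a :: (t ++ [a])).IsChain r

theorem apply_mem_of_isChain {α : Type*} {f : α → α} {a b : α} {t : List α}
    (h : (a :: (t ++ [b])).IsChain fun x y => f x = y) {x : α} (hx : x ∈ a :: t) :
    f x ∈ t ++ [b] := by
  induction t generalizing a with
  | nil => simp_all
  | cons c t ih =>
    rw [List.cons_append, List.isChain_cons_cons] at h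
    rcases List.mem_cons.1 hx with rfl | hx
    · simp [h.1]
    · exact List.mem_cons_of_mem _ (ih h.2 hx)

theorem sameCycle_of_isChain {α : Type*} {f : Equiv.Perm α} {a b : α} {t : List α}
    (h : (a :: (t ++ [b])).IsChain fun x y => f x = y) {x : α} (hx : x ∈ a :: t) :
    f.SameCycle a x := by
  induction t generalizing a with
  | nil => rw [List.mem_singleton.1 hx]
  | cons c t ih =>
    rw [List.cons_append, List.isChain_cons_cons] at h
    rcases List.mem_cons.1 hx with rfl | hx
    · exact Equiv.Perm.SameCycle.refl _ _
    · have := ih h.2 hx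
      rw [← h.1] at this
      exact Equiv.Perm.sameCycle_apply_left.1 this

theorem IsCyclicChain.sameCycle_iff {α : Type*} [Finite α] {f : Equiv.Perm α} {l : List α}
    (h : IsCyclicChain (fun x y => f x = y) l) {x y : α} (hx : x ∈ l) :
    f.SameCycle x y ↔ y ∈ l := by
  obtain ⟨a, t, rfl, h⟩ := h
  constructor
  · intro hxy
    obtain ⟨k, rfl⟩ := hxy.exists_nat_pow_eq
    clear hxy
    induction k with
    | zero => exact hx
    | succ k ih =>
      rw [pow_succ', Equiv.Perm.mul_apply]
      have := apply_mem_of_isChain h ih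
      simp only [List.mem_append, List.mem_cons, List.not_mem_nil, or_false] at this ⊢
      exact this.symm
  · intro hy
    exact (sameCycle_of_isChain h hx).symm.trans (sameCycle_of_isChain h hy)

theorem IsCyclicChain.ncard_sameCycle {α : Type*} [Finite α] {f : Equiv.Perm α} {l : List α}
    (h : IsCyclicChain (fun x y => f x = y) l) (hl : l.Nodup) {x : α} (hx : x ∈ l) :
    Set.ncard {y | f.SameCycle x y} = l.length := by
  have : {y | f.SameCycle x y} = (l.toFinset : Set α) := by
    ext y
    simp [h.sameCycle_iff hx]
  rw [this, Set.ncard_coe_finset, List.toFinset_card_of_nodup hl]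

theorem rauzyRank_eq {m : ℕ} {σ : Equiv.Perm (Fin (m + 1))} {p : List (Fin (m + 1))}
    (hp : IsCyclicChain (fun x y => cycleMap σ x = y) (0 :: p)) (hn : (0 :: p).Nodup) :
    rauzyRank σ = p.length := by
  simp [rauzyRank, hp.ncard_sameCycle hn List.mem_cons_self]

theorem rauzyLambda_eq {m : ℕ} {σ : Equiv.Perm (Fin (m + 1))} {p : List (Fin (m + 1))}
    {Ls : List (List (Fin (m + 1)))}
    (hp : IsCyclicChain (fun x y => cycleMap σ x = y) (0 :: p))
    (hL : ∀ l ∈ Ls, IsCyclicChain (fun x y => cycleMap σ x = y) l)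
    (hn : (0 :: p ++ Ls.flatten).Nodup) (hc : ∀ x, x ∈ 0 :: p ++ Ls.flatten) :
    rauzyLambda σ = (Ls.map List.length : Multiset ℕ) := by
  obtain ⟨-, hn2, hn3⟩ := List.nodup_append.1 hn
  obtain ⟨hn4, hn5⟩ := List.nodup_flatten.1 hn2
  have hex : ∀ l : List (Fin (m + 1)), ∃ x, l ∈ Ls → x ∈ l ∧ ∀ y ∈ l, x ≤ y := by
    intro l
    by_cases hl : l ∈ Ls
    · obtain ⟨a, t, rfl, -⟩ := hL l hl
      have hne : (a :: t).toFinset.Nonempty := ⟨a, by simp⟩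
      refine ⟨(a :: t).toFinset.min' hne, fun _ => ⟨?_, fun y hy => ?_⟩⟩
      · exact List.mem_toFinset.1 (Finset.min'_mem _ hne)
      · exact Finset.min'_le _ _ (List.mem_toFinset.2 hy)
    · exact ⟨0, fun h => absurd h hl⟩
  choose μ hμ using hex
  have hmem : ∀ l ∈ Ls, μ l ∈ l := fun l hl => (hμ l hl).1
  have hval : (Finset.univ.filter fun j =>
      (∀ x, (cycleMap σ).SameCycle j x → j ≤ x) ∧ ¬ (cycleMap σ).SameCycle 0 j).val =
      (Ls.map μ : Multiset (Fin (m + 1))) := by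
    rw [Multiset.Nodup.ext (Finset.nodup _)]
    · intro j
      rw [Finset.mem_val, Finset.mem_filter, Multiset.mem_coe, List.mem_map]
      constructor
      · rintro ⟨-, h1, h2⟩
        rw [hp.sameCycle_iff List.mem_cons_self] at h2
        obtain ⟨l, hl, hj⟩ := List.mem_flatten.1 ((List.mem_append.1 (hc j)).resolve_left h2)
        refine ⟨l, hl, le_antisymm ((hμ l hl).2 j hj) (h1 _ ?_)⟩
        exact ((hL l hl).sameCycle_iff hj).2 (hmem l hl)
      · rintro ⟨l, hl, rfl⟩
        refine ⟨Finset.mem_univ _, fun x hx => ?_, fun h => ?_⟩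
        · exact (hμ l hl).2 x (((hL l hl).sameCycle_iff (hmem l hl)).1 hx)
        · rw [hp.sameCycle_iff List.mem_cons_self] at h
          exact hn3 _ h _ (List.mem_flatten.2 ⟨l, hl, hmem l hl⟩) rfl
    · rw [Multiset.coe_nodup, List.Nodup, List.pairwise_map]
      refine hn5.imp_of_mem fun {l l'} hl hl' hd he => ?_
      exact hd (hmem l hl) (he ▸ hmem l' hl')
  simp only [rauzyLambda]
  rw [hval, Multiset.map_coe, List.map_map]
  congr 1
  apply List.map_congr_left
  intro l hl
  exact (hL l hl).ncard_sameCycle (hn4 l hl) (hmem l hl)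

theorem rauzyIrreducible_of_map_zero {m : ℕ} {σ : Equiv.Perm (Fin (m + 1))} (h0 : σ 0 = 0) :
    rauzyIrreducible σ := by
  intro k hk hkn h
  have : (0 : Fin (m + 1)) ∈ Finset.univ.filter fun j : Fin (m + 1) => m + 1 - k ≤ j.val := by
    rw [← h]
    exact Finset.mem_image.2 ⟨0, by simp; omega, h0⟩
  simp at this
  omega

/-- The steps of the cycle construction for the permutation written `0 :: w` in one-line
notation, when `w` starts with its largest entry. -/
def CycleStep (w : List ℕ) (a b : ℕ) : Prop :=
  (a = 0 ∧ b = 1) ∨ (b = 0 ∧ [a] <:+ w) ∨ ∃ c, [a, c] <:+: w ∧ b = c + 1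

/-- `w` is a permutation of `{1,…,m}` starting with `m`, and the permutation `0 :: w` has rank
path `p` and closed cycles `Ls`. -/
structure CycleData (m : ℕ) (w p : List ℕ) (Ls : List (List ℕ)) : Prop where
  perm : w.Perm (List.range' 1 m)
  head : ∃ t, w = m :: t
  path : IsCyclicChain (CycleStep w) (0 :: p)
  cycles : ∀ l ∈ Ls, IsCyclicChain (CycleStep w) l
  cover : (0 :: p ++ Ls.flatten).Perm (List.range (m + 1))

theorem CycleData.length_eq {m : ℕ} {w p : List ℕ} {Ls : List (List ℕ)}
    (h : CycleData m w p Ls) : w.length = m := by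
  simpa using h.perm.length_eq

theorem CycleData.mem_iff {m : ℕ} {w p : List ℕ} {Ls : List (List ℕ)}
    (h : CycleData m w p Ls) {x : ℕ} : x ∈ w ↔ 1 ≤ x ∧ x ≤ m := by
  rw [h.perm.mem_iff, List.mem_range'_1]
  omega

theorem CycleData.nodup {m : ℕ} {w p : List ℕ} {Ls : List (List ℕ)}
    (h : CycleData m w p Ls) : (0 :: w).Nodup := by
  rw [List.nodup_cons, h.mem_iff]
  exact ⟨by omega, h.perm.nodup_iff.2 List.nodup_range'⟩

theorem CycleData.ascSum_neg_one {m : ℕ} {w p : List ℕ} {Ls : List (List ℕ)}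
    (h : CycleData m w p Ls) : ascSum (-1) w = 0 := by
  obtain ⟨t, ht⟩ := h.head
  have hmax : ∀ b ∈ t, b < m := fun b hb => by
    have h1 := h.mem_iff.1 (ht ▸ List.mem_cons_of_mem _ hb)
    have h2 := (List.nodup_cons.1 (ht ▸ (List.nodup_cons.1 h.nodup).2)).1
    have : b ≠ m := fun e => h2 (e ▸ hb)
    omega
  rw [ht, ascSum_cons_of_forall_lt _ hmax]
  simp

theorem CycleData.lt_length {m : ℕ} {w p : List ℕ} {Ls : List (List ℕ)}
    (h : CycleData m w p Ls) (i : Fin (m + 1)) : i.val < (0 :: w).length := by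
  rw [List.length_cons, h.length_eq]
  exact i.isLt

/-- The permutation written `0 :: w` in one-line notation. -/
noncomputable def CycleData.toPerm {m : ℕ} {w p : List ℕ} {Ls : List (List ℕ)}
    (h : CycleData m w p Ls) : Equiv.Perm (Fin (m + 1)) :=
  Equiv.ofBijective
    (fun i => ⟨(0 :: w)[i.val]'(h.lt_length i), by
      have hm : (0 :: w)[i.val]'(h.lt_length i) ∈ 0 :: w := List.getElem_mem _
      rcases List.mem_cons.1 hm with h' | h'
      · omega
      · have := h.mem_iff.1 h'
        omega⟩)
    (Finite.injective_iff_bijective.1 fun i j hij => by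
      have := h.nodup.getElem_inj_iff.1 (Fin.mk.inj hij)
      exact Fin.ext this)

theorem CycleData.val_toPerm {m : ℕ} {w p : List ℕ} {Ls : List (List ℕ)}
    (h : CycleData m w p Ls) (i : Fin (m + 1)) :
    (h.toPerm i).val = (0 :: w)[i.val]'(h.lt_length i) := rfl

theorem CycleData.toPerm_zero {m : ℕ} {w p : List ℕ} {Ls : List (List ℕ)}
    (h : CycleData m w p Ls) : h.toPerm 0 = 0 := Fin.ext (by simp [h.val_toPerm])

theorem CycleData.cycleMap_eq {m : ℕ} {w p : List ℕ} {Ls : List (List ℕ)}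
    (h : CycleData m w p Ls) {x y : Fin (m + 1)} (hxy : CycleStep w x y) :
    cycleMap h.toPerm x = y := by
  have h0 := h.toPerm_zero
  obtain ⟨t, ht⟩ := h.head
  have hm : m ≠ 0 := by
    rintro rfl
    have := h.length_eq
    simp [ht] at this
  have hf : ∀ i, cycleMap h.toPerm (h.toPerm i) =
      Equiv.swap 0 (Fin.last m) (h.toPerm (i + 1)) + 1 := fun i => by
    simp [cycleMap, h0, finRotate_apply]
  have h1 : h.toPerm 1 = Fin.last m := by
    apply Fin.ext
    have : ((1 : Fin (m + 1)) : ℕ) = 1 := by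
      obtain ⟨k, rfl⟩ := Nat.exists_eq_succ_of_ne_zero hm
      rfl
    rw [h.val_toPerm]
    simp only [this, ht]
    rfl
  have hl : (Fin.last m) + 1 = 0 := by simp
  rcases hxy with ⟨hx, hy⟩ | ⟨hy, hx⟩ | ⟨c, hc, hy⟩
  · have hx : x = h.toPerm 0 := by rw [h0]; exact Fin.ext hx
    rw [hx, hf, zero_add, h1, Equiv.swap_apply_right, zero_add]
    apply Fin.ext
    rw [hy]
    obtain ⟨k, rfl⟩ := Nat.exists_eq_succ_of_ne_zero hm
    rfl
  · have hx : x = h.toPerm (Fin.last m) := by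
      apply Fin.ext
      obtain ⟨u, rfl⟩ := hx
      have := h.length_eq
      simp only [List.length_append, List.length_singleton] at this
      subst this
      simp [h.val_toPerm]
    rw [hx, hf, hl, h0, Equiv.swap_apply_left, hl]
    exact Fin.ext hy.symm
  · obtain ⟨u, v, huv⟩ := hc
    have hlen := h.length_eq
    rw [← huv] at hlen
    simp only [List.length_append, List.length_cons, List.length_nil] at hlen
    set i : Fin (m + 1) := ⟨u.length + 1, by omega⟩ with hi
    have hi1 : (i + 1).val = u.length + 2 := by
      rw [Fin.val_add_one_of_lt (by rw [Fin.lt_def, Fin.val_last, hi]; simp; omega)]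
    have hx : x = h.toPerm i := by
      apply Fin.ext
      rw [h.val_toPerm]
      simp [hi, ← huv]
    have hc : (h.toPerm (i + 1)).val = c := by
      rw [h.val_toPerm]
      simp [hi1, ← huv]
    have hc0 : h.toPerm (i + 1) ≠ 0 := by
      rw [← h0]
      intro he
      have := congrArg Fin.val (h.toPerm.injective he)
      rw [hi1] at this
      simp at this
    have hcm : h.toPerm (i + 1) ≠ Fin.last m := by
      rw [← h1]
      intro he
      have := congrArg Fin.val (h.toPerm.injective he)
      rw [hi1] at this
      have h11 : ((1 : Fin (m + 1)) : ℕ) ≤ 1 := by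
        rw [Fin.val_one']
        exact Nat.mod_le _ _
      omega
    rw [hx, hf, Equiv.swap_apply_of_ne_of_ne hc0 hcm]
    apply Fin.ext
    rw [Fin.val_add_one_of_lt (lt_of_le_of_ne (Fin.le_last _) hcm), hc, hy]

theorem CycleData.toPerm_spec {m : ℕ} {w p : List ℕ} {Ls : List (List ℕ)}
    (h : CycleData m w p Ls) :
    rauzyIrreducible h.toPerm ∧ rauzyLambda h.toPerm = (Ls.map List.length : Multiset ℕ) ∧
      rauzyRank h.toPerm = p.length ∧ arfBar h.toPerm = - ascSum 1 w := by
  set φ : ℕ → Fin (m + 1) := Fin.ofNat (m + 1) with hφ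
  have hφv : ∀ x < m + 1, (φ x).val = x := fun x hx => Nat.mod_eq_of_lt hx
  have hcov : ∀ x, x ∈ 0 :: p ++ Ls.flatten ↔ x < m + 1 := fun x => by
    rw [h.cover.mem_iff, List.mem_range]
  have hchain : ∀ l, IsCyclicChain (CycleStep w) l → (∀ x ∈ l, x < m + 1) →
      IsCyclicChain (fun x y => cycleMap h.toPerm x = y) (l.map φ) := by
    rintro _ ⟨a, t, rfl, hl⟩ hlt
    refine ⟨φ a, t.map φ, rfl, ?_⟩
    have : (φ a :: (t.map φ ++ [φ a])) = (a :: (t ++ [a])).map φ := by simp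
    rw [this, List.isChain_map]
    refine hl.imp_of_mem_imp fun x y hx hy hxy => ?_
    have hlt' : ∀ z ∈ a :: (t ++ [a]), z < m + 1 := fun z hz => hlt z (by simp at hz ⊢; tauto)
    apply h.cycleMap_eq
    rwa [hφv x (hlt' x hx), hφv y (hlt' y hy)]
  have hperm : (0 :: p.map φ ++ (Ls.map (List.map φ)).flatten).Perm
      ((List.range (m + 1)).map φ) := by
    have := h.cover.map φ
    rwa [List.map_append, List.map_flatten, List.map_cons] at this
  have hnd : (0 :: p.map φ ++ (Ls.map (List.map φ)).flatten).Nodup := by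
    rw [hperm.nodup_iff]
    refine List.Nodup.map_on (fun x hx y hy hxy => ?_) List.nodup_range
    rw [← hφv x (List.mem_range.1 hx), hxy, hφv y (List.mem_range.1 hy)]
  have hmem : ∀ x, x ∈ 0 :: p.map φ ++ (Ls.map (List.map φ)).flatten := fun x => by
    rw [hperm.mem_iff]
    exact List.mem_map.2 ⟨x.val, List.mem_range.2 x.isLt, Fin.ext (hφv _ x.isLt)⟩
  have hpath : IsCyclicChain (fun x y => cycleMap h.toPerm x = y) (0 :: p.map φ) :=
    hchain _ h.path fun x hx => (hcov x).1 (List.mem_append_left _ hx)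
  have hcyc : ∀ l ∈ Ls.map (List.map φ), IsCyclicChain (fun x y => cycleMap h.toPerm x = y) l := by
    intro l hl
    obtain ⟨l, hlL, rfl⟩ := List.mem_map.1 hl
    exact hchain l (h.cycles l hlL) fun x hx =>
      (hcov x).1 (List.mem_append_right _ (List.mem_flatten.2 ⟨l, hlL, hx⟩))
  refine ⟨rauzyIrreducible_of_map_zero h.toPerm_zero, ?_, ?_, ?_⟩
  · rw [rauzyLambda_eq hpath hcyc hnd hmem, List.map_map]
    simp [Function.comp_def]
  · rw [rauzyRank_eq hpath (List.nodup_append.1 hnd).1, List.length_map]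
  · have hw : ((List.finRange (m + 1)).map fun i => (h.toPerm i).val) = 0 :: w := by
      apply List.ext_getElem
      · simp [h.length_eq]
      · intro i h1 h2
        simp [h.val_toPerm]
    rw [arfBar_eq_ascSum, hw, ascSum_cons_of_forall_gt _ fun b hb => (h.mem_iff.1 hb).1,
      h.ascSum_neg_one]
    ring_nf

theorem CycleStep.of_infix {w w' : List ℕ} (h : w <:+: w') {a b : ℕ} (hb : b ≠ 0)
    (hab : CycleStep w a b) : CycleStep w' a b := by
  rcases hab with hab | ⟨rfl, -⟩ | ⟨c, hc, rfl⟩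
  · exact Or.inl hab
  · exact absurd rfl hb
  · exact Or.inr (Or.inr ⟨c, hc.trans h, rfl⟩)

theorem CycleStep.suffix_of_zero {w : List ℕ} {a : ℕ} (h : CycleStep w a 0) : [a] <:+ w := by
  rcases h with ⟨-, h⟩ | ⟨-, h⟩ | ⟨c, -, h⟩
  · omega
  · exact h
  · omega

/-- Reading a closed chain from its first element to its last one, then back to the first. -/
theorem isChain_close_iff {r : ℕ → ℕ → Prop} {a : ℕ} {t : List ℕ} {b : ℕ} :
    (a :: (t ++ [b])).IsChain r ↔
      (a :: t).IsChain r ∧ r ((a :: t).getLast (List.cons_ne_nil _ _)) b := by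
  rw [← List.cons_append, List.isChain_append]
  simp [List.getLast?_eq_getLast_of_ne_nil (List.cons_ne_nil a t)]

theorem IsCyclicChain.mono {α : Type*} {r r' : α → α → Prop} {l : List α}
    (h : ∀ a ∈ l, ∀ b ∈ l, r a b → r' a b) (hl : IsCyclicChain r l) : IsCyclicChain r' l := by
  obtain ⟨a, t, rfl, hl⟩ := hl
  refine ⟨a, t, rfl, hl.imp_of_mem_imp fun x y hx hy => h x ?_ y ?_⟩ <;>
    simp at hx hy ⊢ <;> tauto

theorem IsCyclicChain.map {α β : Type*} {r : α → α → Prop} {r' : β → β → Prop} {l : List α}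
    (f : α → β) (h : ∀ a ∈ l, ∀ b ∈ l, r a b → r' (f a) (f b)) (hl : IsCyclicChain r l) :
    IsCyclicChain r' (l.map f) := by
  obtain ⟨a, t, rfl, hl⟩ := hl
  refine ⟨f a, t.map f, rfl, ?_⟩
  have : (f a :: (t.map f ++ [f a])) = (a :: (t ++ [a])).map f := by simp
  rw [this, List.isChain_map]
  refine hl.imp_of_mem_imp fun x y hx hy => h x ?_ y ?_ <;>
    simp at hx hy ⊢ <;> tauto

theorem CycleData.ne_zero_of_mem {m : ℕ} {w p : List ℕ} {Ls : List (List ℕ)}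
    (h : CycleData m w p Ls) {x : ℕ} (hx : x ∈ p ++ Ls.flatten) : x ≠ 0 := by
  have hn : (0 :: (p ++ Ls.flatten)).Nodup := h.cover.nodup_iff.2 List.nodup_range
  exact fun e => (List.nodup_cons.1 hn).1 (e ▸ hx)

/-- The rank path of `h`, cut before it returns to `0`. -/
theorem CycleData.path_isChain {m : ℕ} {w p : List ℕ} {Ls : List (List ℕ)}
    (h : CycleData m w p Ls) :
    (0 :: p).IsChain (CycleStep w) ∧ [(0 :: p).getLast (List.cons_ne_nil _ _)] <:+ w := by
  obtain ⟨a, t, hat, hp⟩ := h.path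
  obtain ⟨rfl, rfl⟩ := List.cons.inj hat
  obtain ⟨h1, h2⟩ := isChain_close_iff.1 hp
  exact ⟨h1, h2.suffix_of_zero⟩

/-- Surrounding `w` by new largest entries only extends the rank path. -/
theorem CycleData.extend {m k : ℕ} {w p : List ℕ} {Ls : List (List ℕ)}
    (h : CycleData m w p Ls) {u q : List ℕ}
    (hu : ((m + k) :: u).Perm (List.range' (m + 1) k)) (hq : q.Perm (List.range' (m + 1) k))
    (hstep : ∀ a, [a] <:+ w → (a :: (q ++ [0])).IsChain (CycleStep ((m + k) :: (w ++ u)))) :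
    CycleData (m + k) ((m + k) :: (w ++ u)) (p ++ q) Ls := by
  have hinf : w <:+: (m + k) :: (w ++ u) := ⟨[m + k], u, by simp⟩
  obtain ⟨h1, h2⟩ := h.path_isChain
  refine ⟨?_, ⟨_, rfl⟩, ⟨0, p ++ q, rfl, ?_⟩, ?_, ?_⟩
  · have e : List.range' 1 (m + k) = List.range' 1 m ++ List.range' (m + 1) k := by
      rw [add_comm m 1, List.range'_append_1]
    rw [e]
    refine List.Perm.trans ?_ (h.perm.append hu)
    exact (List.perm_middle).symm
  · have h3 : (0 :: p).IsChain (CycleStep ((m + k) :: (w ++ u))) := by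
      refine h1.imp_of_mem_tail_imp fun a b _ hb hab => hab.of_infix hinf ?_
      exact h.ne_zero_of_mem (List.mem_append_left _ hb)
    have h4 := hstep _ h2
    have h5 : (0 :: (p ++ q ++ [0])) = (0 :: p) ++ (q ++ [0]) := by simp
    rw [h5, List.isChain_append]
    refine ⟨h3, h4.tail, fun x hx y hy => ?_⟩
    rw [List.getLast?_eq_getLast_of_ne_nil (List.cons_ne_nil 0 p), Option.mem_some_iff] at hx
    rw [hx] at h4
    exact h4.rel_head? hy
  · intro l hl
    refine (h.cycles l hl).mono fun a _ b hb hab => hab.of_infix hinf ?_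
    exact h.ne_zero_of_mem (List.mem_append_right _ (List.mem_flatten.2 ⟨l, hl, hb⟩))
  · have e : List.range (m + k + 1) = List.range (m + 1) ++ List.range' (m + 1) k := by
      rw [List.range_eq_range', List.range_eq_range',
        show m + k + 1 = (m + 1) + k by ring, ← List.range'_append_1, zero_add]
    rw [e]
    refine List.Perm.trans ?_ (h.cover.append hq)
    simp only [List.cons_append, List.append_assoc]
    exact ((List.perm_append_comm).append_left p).cons 0

theorem CycleData.extend_two {m : ℕ} {w p : List ℕ} {Ls : List (List ℕ)}
    (h : CycleData m w p Ls) :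
    CycleData (m + 2) ((m + 2) :: (w ++ [m + 1])) (p ++ [m + 2, m + 1]) Ls := by
  have e : List.range' (m + 1) 2 = [m + 1, m + 2] := rfl
  obtain ⟨t, ht⟩ := h.head
  refine h.extend ?_ ?_ fun a ha => ?_
  · rw [e]; exact List.Perm.swap _ _ _
  · rw [e]; exact List.Perm.swap _ _ _
  · obtain ⟨v, hv⟩ := ha
    simp only [List.cons_append, List.nil_append, List.isChain_cons_cons, List.isChain_singleton,
      and_true]
    refine ⟨Or.inr (Or.inr ⟨m + 1, ⟨(m + 2) :: v, [], by simp [← hv]⟩, rfl⟩),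
      Or.inr (Or.inr ⟨m, ⟨[], t ++ [m + 1], by simp [ht]⟩, rfl⟩),
      Or.inr (Or.inl ⟨rfl, ⟨(m + 2) :: w, by simp⟩⟩)⟩

theorem CycleData.extend_four {m : ℕ} {w p : List ℕ} {Ls : List (List ℕ)}
    (h : CycleData m w p Ls) :
    CycleData (m + 4) ((m + 4) :: (w ++ [m + 1, m + 2, m + 3]))
      (p ++ [m + 2, m + 4, m + 1, m + 3]) Ls := by
  have e : List.range' (m + 1) 4 = [m + 1, m + 2, m + 3, m + 4] := rfl
  obtain ⟨t, ht⟩ := h.head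
  refine h.extend ?_ ?_ fun a ha => ?_
  · rw [e]; exact (List.perm_append_singleton (m + 4) [m + 1, m + 2, m + 3]).symm
  · rw [e, List.perm_ext_iff_of_nodup (by simp) (by simp)]
    intro x
    simp
    tauto
  · obtain ⟨v, hv⟩ := ha
    simp only [List.cons_append, List.nil_append, List.isChain_cons_cons, List.isChain_singleton,
      and_true]
    refine ⟨Or.inr (Or.inr ⟨m + 1, ⟨(m + 4) :: v, [m + 2, m + 3], by simp [← hv]⟩, rfl⟩),
      Or.inr (Or.inr ⟨m + 3, ⟨(m + 4) :: (w ++ [m + 1]), [], by simp⟩, rfl⟩),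
      Or.inr (Or.inr ⟨m, ⟨[], t ++ [m + 1, m + 2, m + 3], by simp [ht]⟩, rfl⟩),
      Or.inr (Or.inr ⟨m + 2, ⟨(m + 4) :: w, [m + 3], by simp⟩, rfl⟩),
      Or.inr (Or.inl ⟨rfl, ⟨(m + 4) :: (w ++ [m + 1, m + 2]), by simp⟩⟩)⟩

/-- Appending a new smallest entry closes up the rank path and starts a rank path of length 1. -/
theorem CycleData.close {m : ℕ} {w p : List ℕ} {Ls : List (List ℕ)} (h : CycleData m w p Ls) :
    CycleData (m + 1) (w.map (· + 1) ++ [1]) [1]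
      (p.map (· + 1) :: Ls.map (List.map (· + 1))) := by
  have hstep : ∀ a b : ℕ, a ≠ 0 → b ≠ 0 → CycleStep w a b →
      CycleStep (w.map (· + 1) ++ [1]) (a + 1) (b + 1) := by
    rintro a b ha hb (⟨h', -⟩ | ⟨h', -⟩ | ⟨c, hc, rfl⟩)
    · exact absurd h' ha
    · exact absurd h' hb
    · exact Or.inr (Or.inr ⟨c + 1,
        (hc.map (· + 1)).trans ⟨[], [1], by simp⟩, rfl⟩)
  obtain ⟨t, ht⟩ := h.head
  have h0 : 0 ∉ w := (List.nodup_cons.1 h.nodup).1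
  obtain ⟨h1, h2⟩ := h.path_isChain
  refine ⟨?_, ⟨t.map (· + 1) ++ [1], by simp [ht]⟩, ⟨0, [1], rfl, ?_⟩, ?_, ?_⟩
  · have e : List.range' 1 (m + 1) = 1 :: (List.range' 1 m).map (· + 1) := by
      rw [List.range'_succ, List.range'_succ_left]
    rw [e]
    exact (List.perm_append_singleton _ _).trans ((h.perm.map _).cons 1)
  · simp only [List.cons_append, List.nil_append, List.isChain_cons_cons, List.isChain_singleton,
      and_true]
    exact ⟨Or.inl ⟨rfl, rfl⟩, Or.inr (Or.inl ⟨rfl, List.suffix_append _ _⟩)⟩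
  · intro l hl
    rcases List.mem_cons.1 hl with rfl | hl
    · cases p with
      | nil => exact absurd (h2.subset (List.mem_singleton_self 0)) h0
      | cons a p =>
        rw [List.isChain_cons_cons] at h1
        have ha : a = 1 := by
          have ha0 : a ≠ 0 := h.ne_zero_of_mem (by simp)
          rcases h1.1 with ⟨-, h'⟩ | ⟨h', -⟩ | ⟨c, hc, -⟩
          · exact h'
          · exact absurd h' ha0
          · exact absurd (hc.subset (by simp)) h0
        subst ha
        refine ⟨2, p.map (· + 1), rfl, isChain_close_iff.2 ⟨?_, ?_⟩⟩
        · have : (2 :: p.map (· + 1)) = (1 :: p).map (· + 1) := rfl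
          rw [this, List.isChain_map]
          refine h1.2.imp_of_mem_imp fun x y hx hy => hstep x y ?_ ?_
          · exact h.ne_zero_of_mem (List.mem_append_left _ hx)
          · exact h.ne_zero_of_mem (List.mem_append_left _ hy)
        · have : (2 :: p.map (· + 1)).getLast (List.cons_ne_nil _ _) =
              (0 :: 1 :: p).getLast (List.cons_ne_nil _ _) + 1 := by
            rw [List.getLast_cons_cons]
            exact List.getLast_map (f := (· + 1)) (l := 1 :: p) (by simp)
          rw [this]
          obtain ⟨v, hv⟩ := h2
          refine Or.inr (Or.inr ⟨1, ⟨v.map (· + 1), [], ?_⟩, rfl⟩)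
          rw [← hv]
          simp
    · obtain ⟨l, hlL, rfl⟩ := List.mem_map.1 hl
      have hne : ∀ x ∈ l, x ≠ 0 := fun x hx =>
        h.ne_zero_of_mem (List.mem_append_right _ (List.mem_flatten.2 ⟨l, hlL, hx⟩))
      exact (h.cycles l hlL).map _ fun a ha b hb => hstep a b (hne a ha) (hne b hb)
  · have e : List.range (m + 1 + 1) = 0 :: (List.range (m + 1)).map (· + 1) :=
      List.range_succ_eq_map
    rw [e]
    have := h.cover.map (· + 1)
    simpa [List.map_flatten] using this.cons 0

theorem CycleData.ascSum_extend_two {m : ℕ} {w p : List ℕ} {Ls : List (List ℕ)}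
    (h : CycleData m w p Ls) : ascSum 1 ((m + 2) :: (w ++ [m + 1])) = 2 * ascSum 1 w := by
  have hlt : ∀ b ∈ w, b < m + 1 := fun b hb => Nat.lt_succ_of_le (h.mem_iff.1 hb).2
  rw [ascSum_cons_of_forall_lt, ascSum_concat_of_forall_lt _ hlt, h.ascSum_neg_one]
  · ring
  · intro b hb
    have := hlt b
    simp at hb
    grind

theorem CycleData.ascSum_extend_four {m : ℕ} {w p : List ℕ} {Ls : List (List ℕ)}
    (h : CycleData m w p Ls) :
    ascSum 1 ((m + 4) :: (w ++ [m + 1, m + 2, m + 3])) = -4 * ascSum 1 w := by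
  have hlt : ∀ b ∈ w, b < m + 1 := fun b hb => Nat.lt_succ_of_le (h.mem_iff.1 hb).2
  have hlt₂ : ∀ b ∈ w ++ [m + 1], b < m + 2 := fun b hb => by
    have := hlt b
    simp at hb
    grind
  have hlt₃ : ∀ b ∈ w ++ [m + 1] ++ [m + 2], b < m + 3 := fun b hb => by
    have := hlt₂ b
    simp at hb this
    grind
  have hlt₄ : ∀ b ∈ w ++ [m + 1] ++ [m + 2] ++ [m + 3], b < m + 4 := fun b hb => by
    have := hlt₃ b
    simp at hb this
    grind
  have e : w ++ [m + 1, m + 2, m + 3] = w ++ [m + 1] ++ [m + 2] ++ [m + 3] := by simp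
  rw [e, ascSum_cons_of_forall_lt _ hlt₄]
  simp only [ascSum_concat_of_forall_lt _ hlt₃, ascSum_concat_of_forall_lt _ hlt₂,
    ascSum_concat_of_forall_lt _ hlt, neg_neg, h.ascSum_neg_one]
  ring

theorem CycleData.ascSum_close {m : ℕ} {w p : List ℕ} {Ls : List (List ℕ)}
    (h : CycleData m w p Ls) : ascSum 1 (w.map (· + 1) ++ [1]) = 2 * ascSum 1 w := by
  rw [ascSum_concat_of_forall_gt, ascSum_map fun a b hab => Nat.succ_lt_succ hab]
  · ring
  · intro b hb
    obtain ⟨c, hc, rfl⟩ := List.mem_map.1 hb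
    exact Nat.lt_succ_of_le (h.mem_iff.1 hc).1

/-- Some permutation with `CycleData` has cycle invariant `(lam, r)`, and its Arf invariant has
the sign of `-ε`. -/
def Realizable (ε : ℤ) (lam : Multiset ℕ) (r : ℕ) : Prop :=
  ∃ w p Ls, CycleData (r + lam.sum) w p Ls ∧ p.length = r ∧
    (Ls.map List.length : Multiset ℕ) = lam ∧ 0 < ε * ascSum 1 w

theorem Realizable.exists_perm {ε : ℤ} {lam : Multiset ℕ} {r : ℕ} (h : Realizable ε lam r) :
    ∃ σ : Equiv.Perm (Fin (r + lam.sum + 1)), rauzyIrreducible σ ∧ rauzyLambda σ = lam ∧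
      rauzyRank σ = r ∧ 0 < -ε * arfBar σ := by
  obtain ⟨w, p, Ls, h, hp, hL, hs⟩ := h
  obtain ⟨h1, h2, h3, h4⟩ := h.toPerm_spec
  exact ⟨h.toPerm, h1, h2.trans hL, h3.trans hp, by rw [h4]; linarith⟩

theorem Realizable.add_two {ε : ℤ} {lam : Multiset ℕ} {r : ℕ} (h : Realizable ε lam r) :
    Realizable ε lam (r + 2) := by
  obtain ⟨w, p, Ls, h, hp, hL, hs⟩ := h
  refine ⟨_, _, Ls, by rw [add_right_comm]; exact h.extend_two, by simp [hp], hL, ?_⟩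
  rw [h.ascSum_extend_two]
  linarith

theorem Realizable.neg_add_four {ε : ℤ} {lam : Multiset ℕ} {r : ℕ} (h : Realizable ε lam r) :
    Realizable (-ε) lam (r + 4) := by
  obtain ⟨w, p, Ls, h, hp, hL, hs⟩ := h
  refine ⟨_, _, Ls, by rw [add_right_comm]; exact h.extend_four, by simp [hp], hL, ?_⟩
  rw [h.ascSum_extend_four]
  linarith

theorem Realizable.cons_one {ε : ℤ} {lam : Multiset ℕ} {r : ℕ} (h : Realizable ε lam r) :
    Realizable ε (r ::ₘ lam) 1 := by
  obtain ⟨w, p, Ls, h, rfl, rfl, hs⟩ := h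
  refine ⟨_, _, _, by rw [Multiset.sum_cons, add_comm]; exact h.close, rfl, ?_, ?_⟩
  · simp [Function.comp_def]
  · rw [h.ascSum_close]
    linarith

theorem Realizable.add_two_mul {ε : ℤ} {lam : Multiset ℕ} {r : ℕ} (h : Realizable ε lam r)
    (k : ℕ) : Realizable ε lam (r + 2 * k) := by
  induction k with
  | zero => exact h
  | succ k ih => exact ih.add_two

theorem Realizable.of_one {ε : ℤ} {lam : Multiset ℕ} (h : Realizable ε lam 1) {r : ℕ}
    (hr : Odd r) : Realizable ε lam r := by
  obtain ⟨k, rfl⟩ := hr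
  rw [add_comm]
  exact h.add_two_mul k

theorem realizable_zero_one : Realizable 1 0 1 := by
  refine ⟨[1], [1], [], ⟨.refl _, ⟨_, rfl⟩, ⟨0, [1], rfl, ?_⟩, by simp, .refl _⟩, rfl, rfl, ?_⟩
  · simp only [List.cons_append, List.nil_append, List.isChain_cons_cons, List.isChain_singleton,
      and_true]
    exact ⟨.inl ⟨rfl, rfl⟩, .inr (.inl ⟨rfl, List.suffix_rfl⟩)⟩
  · decide

theorem realizable_neg_singleton_three : Realizable (-1) {3} 3 := by
  have hs : ∀ {a b : ℕ}, [a, b] <:+: [6, 1, 2, 3, 4, 5] →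
      CycleStep [6, 1, 2, 3, 4, 5] a (b + 1) := fun h => .inr (.inr ⟨_, h, rfl⟩)
  refine ⟨[6, 1, 2, 3, 4, 5], [1, 3, 5], [[2, 4, 6]],
    ⟨by decide, ⟨_, rfl⟩, ⟨0, [1, 3, 5], rfl, ?_⟩, ?_, by decide⟩, rfl, rfl, ?_⟩
  · simp only [List.cons_append, List.nil_append, List.isChain_cons_cons, List.isChain_singleton,
      and_true]
    exact ⟨.inl ⟨rfl, rfl⟩, hs (by decide), hs (by decide), .inr (.inl ⟨rfl, by decide⟩)⟩
  · simp only [List.mem_singleton, forall_eq]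
    refine ⟨2, [4, 6], rfl, ?_⟩
    simp only [List.cons_append, List.nil_append, List.isChain_cons_cons, List.isChain_singleton,
      and_true]
    exact ⟨hs (by decide), hs (by decide), hs (by decide)⟩
  · decide

theorem realizable_one {lam : Multiset ℕ} (hlam : ∀ c ∈ lam, Odd c) : Realizable 1 lam 1 := by
  induction lam using Multiset.induction with
  | empty => exact realizable_zero_one
  | cons c lam ih =>
    have h := ih fun d hd => hlam d (Multiset.mem_cons_of_mem hd)
    exact (h.of_one (hlam c (Multiset.mem_cons_self c lam))).cons_one

theorem realizable_neg_of_five_le {lam : Multiset ℕ} (hlam : ∀ c ∈ lam, Odd c) {r : ℕ}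
    (hr : Odd r) (hr5 : 5 ≤ r) : Realizable (-1) lam r := by
  obtain ⟨k, rfl⟩ := hr
  have h := (realizable_one hlam).neg_add_four.add_two_mul (k - 2)
  rwa [show 1 + 4 + 2 * (k - 2) = 2 * k + 1 by omega] at h

theorem realizable_neg_replicate_three (k : ℕ) :
    Realizable (-1) (Multiset.replicate (k + 2) 3) 1 := by
  induction k with
  | zero => exact realizable_neg_singleton_three.cons_one
  | succ k ih => exact (ih.of_one (by decide)).cons_one

theorem realizable_neg {lam : Multiset ℕ} (hlam : ∀ c ∈ lam, Odd c ∧ 3 ≤ c) {r : ℕ}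
    (hr : Odd r) (hsum : 8 ≤ r + lam.sum) : Realizable (-1) lam r := by
  by_cases hr5 : 5 ≤ r
  · exact realizable_neg_of_five_le (fun c hc => (hlam c hc).1) hr hr5
  refine Realizable.of_one ?_ hr
  by_cases h5 : ∃ c ∈ lam, 5 ≤ c
  · obtain ⟨c, hc, hc5⟩ := h5
    obtain ⟨lam, rfl⟩ := Multiset.exists_cons_of_mem hc
    refine (realizable_neg_of_five_le (fun d hd => ?_) (hlam c hc).1 hc5).cons_one
    exact (hlam d (Multiset.mem_cons_of_mem hd)).1
  · push Not at h5
    have h3 : lam = Multiset.replicate lam.card 3 := by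
      refine Multiset.eq_replicate_card.2 fun c hc => ?_
      obtain ⟨⟨k, rfl⟩, h3⟩ := hlam c hc
      have := h5 _ hc
      omega
    have hcard : 2 ≤ lam.card := by
      rw [h3, Multiset.sum_replicate, smul_eq_mul] at hsum
      obtain ⟨k, rfl⟩ := hr
      omega
    obtain ⟨k, hk⟩ := Nat.exists_eq_add_of_le' hcard
    rw [h3, hk]
    exact realizable_neg_replicate_three k

/-- Existence of two (non-connected) classes for each all-odd invariant `(λ, r)`. -/
theorem two_classes_for_odd_invariants {n : ℕ} (hn : 9 ≤ n) (lam : Multiset ℕ)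
    (hlam : ∀ c ∈ lam, Odd c ∧ 3 ≤ c) (r : ℕ) (hr1 : 1 ≤ r) (hrodd : Odd r)
    (hsum : r + lam.sum = n - 1) :
    ∃ σp σm : Equiv.Perm (Fin n),
      rauzyIrreducible σp ∧ rauzyIrreducible σm ∧
      rauzyLambda σp = lam ∧ rauzyRank σp = r ∧
      rauzyLambda σm = lam ∧ rauzyRank σm = r ∧
      0 < arfBar σp ∧ arfBar σm < 0 ∧ ¬ rauzyConnected σp σm := by
  obtain rfl : n = r + lam.sum + 1 := by omega
  obtain ⟨σp, hp1, hp2, hp3, hp4⟩ := (realizable_neg hlam hrodd (by omega)).exists_perm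
  obtain ⟨σm, hm1, hm2, hm3, hm4⟩ :=
    ((realizable_one fun c hc => (hlam c hc).1).of_one hrodd).exists_perm
  refine ⟨σp, σm, hp1, hm1, hp2, hp3, hm2, hm3, by linarith, by linarith, fun h => ?_⟩
  have := arfBar_eq_of_rauzyConnected h
  linarith

end Rauzy
end
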